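/- arXiv:1404.7587 — 3 statements merged into one kernel-verified Lean document; each statement's English description precedes it below -/
import Mathlib

section
/- Let k be a field of characteristic 0, m ≥ 3 an integer, and n, p ≥ 0. For any g ∈ SL_m(k[x₁^{±1},…,xₙ^{±1}][y₁,…,y_p]), let g₀ ∈ SL_m(k[x₁^{±1},…,xₙ^{±1}]) be the matrix obtained from g by the substitution y₁ = … = y_p = 0. Then g·g₀⁻¹ ∈ E_m(k[x₁^{±1},…,xₙ^{±1}][y₁,…,y_p]) (where g₀ is viewed in the larger ring via the canonical inclusion). Equivalently, the natural map K1^{SL_m}(k[x₁^{±1},…,xₙ^{±1}]) → K1^{SL_m}(k[x₁^{±1},…,xₙ^{±1}][y₁,…,y_p]) is an isomorphism. -/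
open Matrix

/-- The elementary subgroup `E_m(S)` of `SL_m(S)`. -/
def ElemSubgroup (m : ℕ) (S : Type*) [CommRing S] :
    Subgroup (SpecialLinearGroup (Fin m) S) :=
  Subgroup.closure { g | ∃ i j : Fin m, ∃ a : S, i ≠ j ∧
    (g : Matrix (Fin m) (Fin m) S) = Matrix.transvection i j a }

namespace SuslinStability
open Matrix.SpecialLinearGroup Polynomial

section Elementary

variable {ι : Type*} [DecidableEq ι] [Fintype ι]
variable {R S A B : Type*} [CommRing R] [CommRing S] [CommRing A] [CommRing B]

/-- The subgroup of `SL_ι(R)` generated by the elementary matrices. -/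
def elem (ι : Type*) [DecidableEq ι] [Fintype ι] (R : Type*) [CommRing R] :
    Subgroup (SpecialLinearGroup ι R) :=
  Subgroup.closure { g | ∃ i j : ι, ∃ a : R, i ≠ j ∧
    (g : Matrix ι ι R) = Matrix.transvection i j a }

/-- The subgroup generated by the elementary matrices with parameters in `φ (u A)`. -/
def elemOf (ι : Type*) [DecidableEq ι] [Fintype ι] (φ : A →+* B) (u : A) :
    Subgroup (SpecialLinearGroup ι B) :=
  Subgroup.closure { g | ∃ i j : ι, ∃ h : i ≠ j, ∃ a : A,
    g = SpecialLinearGroup.transvection h (φ (u * a)) }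

theorem transvection_mem_elem {i j : ι} (h : i ≠ j) (c : R) :
    SpecialLinearGroup.transvection h c ∈ elem ι R :=
  Subgroup.subset_closure ⟨i, j, c, h, rfl⟩

theorem transvection_mem_elemOf {φ : A →+* B} {u : A} {i j : ι} (h : i ≠ j) {c : B}
    (hc : ∃ a, c = φ (u * a)) : SpecialLinearGroup.transvection h c ∈ elemOf ι φ u := by
  obtain ⟨a, rfl⟩ := hc
  exact Subgroup.subset_closure ⟨i, j, h, a, rfl⟩

theorem elem_le {H : Subgroup (SpecialLinearGroup ι R)}
    (hH : ∀ (i j : ι) (h : i ≠ j) (c : R), SpecialLinearGroup.transvection h c ∈ H) :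
    elem ι R ≤ H := by
  refine (Subgroup.closure_le _).2 ?_
  rintro g ⟨i, j, a, h, hg⟩
  have : g = SpecialLinearGroup.transvection h a := Subtype.ext hg
  rw [this]
  exact hH i j h a

theorem elem_induction_left {p : SpecialLinearGroup ι R → Prop} (one : p 1)
    (mul : ∀ (i j : ι) (h : i ≠ j) (c : R) (g : SpecialLinearGroup ι R),
      p g → p (SpecialLinearGroup.transvection h c * g))
    {g : SpecialLinearGroup ι R} (hg : g ∈ elem ι R) : p g := by
  induction hg using Subgroup.closure_induction_left with
  | one => exact one
  | mul_left x hx y hy ih =>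
    obtain ⟨i, j, a, h, hg⟩ := hx
    have : x = SpecialLinearGroup.transvection h a := Subtype.ext hg
    rw [this]
    exact mul i j h a y ih
  | inv_mul_cancel x hx y hy ih =>
    obtain ⟨i, j, a, h, hg⟩ := hx
    have : x = SpecialLinearGroup.transvection h a := Subtype.ext hg
    rw [this, transvection_inv]
    exact mul i j h _ y ih

theorem map_transvection (f : R →+* S) {i j : ι} (h : i ≠ j) (c : R) :
    SpecialLinearGroup.map f (SpecialLinearGroup.transvection h c) =
      SpecialLinearGroup.transvection h (f c) := by
  apply Subtype.ext
  change (1 + Matrix.single i j c).map f = 1 + Matrix.single i j (f c)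
  rw [Matrix.map_add _ (map_add f), Matrix.map_one _ (map_zero f) (map_one f),
    Matrix.map_single]

theorem map_mem_elem (f : R →+* S) {g : SpecialLinearGroup ι R} (hg : g ∈ elem ι R) :
    SpecialLinearGroup.map f g ∈ elem ι S := by
  have : elem ι R ≤ (elem ι S).comap (SpecialLinearGroup.map f) := by
    refine elem_le fun i j h c => ?_
    rw [Subgroup.mem_comap, map_transvection]
    exact transvection_mem_elem h _
  exact this hg

theorem elemOf_le_map (φ : A →+* B) (u : A) :
    elemOf ι φ u ≤ (elem ι A).map (SpecialLinearGroup.map φ) := by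
  refine (Subgroup.closure_le _).2 ?_
  rintro g ⟨i, j, h, a, rfl⟩
  exact ⟨_, transvection_mem_elem h (u * a), map_transvection φ h _⟩

theorem transvection_conj_of_ne {i j k l : ι} (hkl : k ≠ l) (hij : i ≠ j) (hli : l ≠ i)
    (hkj : k ≠ j) (c y : R) :
    SpecialLinearGroup.transvection hkl c * SpecialLinearGroup.transvection hij y *
      (SpecialLinearGroup.transvection hkl c)⁻¹ = SpecialLinearGroup.transvection hij y := by
  rw [mul_inv_eq_iff_eq_mul]
  apply Subtype.ext
  simp [transvection_coe, mul_add, add_mul, single_mul_single_of_ne, hli, hkj.symm]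
  abel

theorem transvection_conj_left {i j k : ι} (hki : k ≠ i) (hij : i ≠ j) (hkj : k ≠ j) (c y : R) :
    SpecialLinearGroup.transvection hki c * SpecialLinearGroup.transvection hij y *
      (SpecialLinearGroup.transvection hki c)⁻¹ =
      SpecialLinearGroup.transvection hkj (c * y) * SpecialLinearGroup.transvection hij y := by
  rw [mul_inv_eq_iff_eq_mul]
  apply Subtype.ext
  simp [transvection_coe, mul_add, add_mul, single_mul_single_of_ne, hkj.symm,
    hij.symm]
  abel

theorem transvection_conj_right {i j l : ι} (hjl : j ≠ l) (hij : i ≠ j) (hil : i ≠ l) (c y : R) :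
    SpecialLinearGroup.transvection hjl c * SpecialLinearGroup.transvection hij y *
      (SpecialLinearGroup.transvection hjl c)⁻¹ =
      SpecialLinearGroup.transvection hil (-(y * c)) * SpecialLinearGroup.transvection hij y := by
  rw [mul_inv_eq_iff_eq_mul]
  apply Subtype.ext
  simp [transvection_coe, mul_add, add_mul, single_mul_single_of_ne, hil.symm, hjl.symm,
    ← single_neg]
  abel

theorem exists_ne_ne (hι : 3 ≤ Fintype.card ι) (i j : ι) : ∃ p, p ≠ i ∧ p ≠ j := by
  have h : ({i, j} : Finset ι).card < (Finset.univ : Finset ι).card :=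
    lt_of_le_of_lt Finset.card_le_two (by rw [Finset.card_univ]; omega)
  obtain ⟨p, -, hp⟩ := Finset.exists_mem_notMem_of_card_lt_card h
  exact ⟨p, by simpa using hp⟩

theorem conj_mem_elemOf_of_not_opposite (φ : A →+* B) (u r : A) (c : B) (c' : A)
    (hc : φ r * c = φ c') {k l : ι} (hkl : k ≠ l) {i j : ι} (hij : i ≠ j)
    (hne : ¬ (l = i ∧ k = j)) (f : A) :
    SpecialLinearGroup.transvection hkl c * SpecialLinearGroup.transvection hij (φ (u * r * f)) *
      (SpecialLinearGroup.transvection hkl c)⁻¹ ∈ elemOf ι φ u := by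
  have h0 : SpecialLinearGroup.transvection hij (φ (u * r * f)) ∈ elemOf ι φ u :=
    transvection_mem_elemOf hij ⟨r * f, by rw [mul_assoc]⟩
  by_cases hli : l = i
  · subst hli
    have hkj : k ≠ j := fun h => hne ⟨rfl, h⟩
    rw [transvection_conj_left hkl hij hkj]
    refine mul_mem (transvection_mem_elemOf _ ⟨c' * f, ?_⟩) h0
    simp only [map_mul, ← hc]; ring
  · by_cases hkj : k = j
    · subst hkj
      rw [transvection_conj_right hkl hij (Ne.symm hli)]
      refine mul_mem (transvection_mem_elemOf _ ⟨-(c' * f), ?_⟩) h0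
      simp only [map_mul, map_neg, ← hc]; ring
    · rwa [transvection_conj_of_ne hkl hij hli hkj]

theorem conj_mem_elemOf (hι : 3 ≤ Fintype.card ι) (φ : A →+* B) (u r : A) (c : B) (c' : A)
    (hc : φ r * c = φ c') {k l : ι} (hkl : k ≠ l) {g : SpecialLinearGroup ι B}
    (hg : g ∈ elemOf ι φ (u * r * (u * r))) :
    SpecialLinearGroup.transvection hkl c * g *
      (SpecialLinearGroup.transvection hkl c)⁻¹ ∈ elemOf ι φ u := by
  have : elemOf ι φ (u * r * (u * r)) ≤ (elemOf ι φ u).comap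
      (MulAut.conj (SpecialLinearGroup.transvection hkl c)).toMonoidHom := by
    refine (Subgroup.closure_le _).2 ?_
    rintro g ⟨i, j, hij, f, rfl⟩
    change SpecialLinearGroup.transvection hkl c * _ *
      (SpecialLinearGroup.transvection hkl c)⁻¹ ∈ elemOf ι φ u
    by_cases hne : l = i ∧ k = j
    · obtain ⟨rfl, rfl⟩ := hne
      obtain ⟨p, hpl, hpk⟩ := exists_ne_ne hι l k
      have key : SpecialLinearGroup.transvection hij (φ (u * r * (u * r) * f)) =
          SpecialLinearGroup.transvection hpl.symm (φ (u * r * 1)) *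
          SpecialLinearGroup.transvection hpk (φ (u * r * f)) *
          (SpecialLinearGroup.transvection hpl.symm (φ (u * r * 1)))⁻¹ *
          (SpecialLinearGroup.transvection hpk (φ (u * r * f)))⁻¹ := by
        rw [transvection_conj_left hpl.symm hpk hij, mul_inv_cancel_right]
        congr 1
        rw [← map_mul]; congr 1; ring
      have h1 := conj_mem_elemOf_of_not_opposite φ u r c c' hc hkl hpl.symm
        (fun h => hpk h.2.symm) 1
      have h2 := conj_mem_elemOf_of_not_opposite φ u r c c' hc hkl hpk
        (fun h => hpl h.1.symm) f
      rw [key]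
      have := mul_mem (mul_mem (mul_mem h1 h2) (inv_mem h1)) (inv_mem h2)
      convert this using 1
      group
    · rw [mul_assoc (u * r)]
      exact conj_mem_elemOf_of_not_opposite φ u r c c' hc hkl hij hne _
  exact this hg

end Elementary

section Patching

variable {ι κ : Type*} [DecidableEq ι] [Fintype ι] {R L : Type*} [CommRing R] [CommRing L]
  [Algebra R L]

theorem exists_smul_eq_map (M : Submonoid R) [IsLocalization M L] (c : L[X]) :
    ∃ r ∈ M, ∃ c' : R[X], mapRingHom (algebraMap R L) (C r) * c =
      mapRingHom (algebraMap R L) c' := by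
  obtain ⟨r, hrM, hr⟩ := IsLocalization.integerNormalization_spec M c
  refine ⟨r, hrM, IsLocalization.integerNormalization M c, ?_⟩
  rw [coe_mapRingHom, hr]
  ext n
  simp [Algebra.smul_def]

theorem exists_translate_mem_elemOf (hι : 3 ≤ Fintype.card ι) (M : Submonoid R)
    [IsLocalization M L] {β : SpecialLinearGroup ι L[X]} (hβ : β ∈ elem ι L[X]) :
    ∀ u ∈ M, ∃ t ∈ M, ∀ a b : R[X],
      SpecialLinearGroup.map (compRingHom (mapRingHom (algebraMap R L) (a + C t * b))) β *
        (SpecialLinearGroup.map (compRingHom (mapRingHom (algebraMap R L) a)) β)⁻¹ ∈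
      elemOf ι (mapRingHom (algebraMap R L)) (C u) := by
  refine elem_induction_left (p := fun β => ∀ u ∈ M, ∃ t ∈ M, ∀ a b : R[X],
      SpecialLinearGroup.map (compRingHom (mapRingHom (algebraMap R L) (a + C t * b))) β *
        (SpecialLinearGroup.map (compRingHom (mapRingHom (algebraMap R L) a)) β)⁻¹ ∈
      elemOf ι (mapRingHom (algebraMap R L)) (C u)) ?_ ?_ hβ
  · intro u _
    exact ⟨1, M.one_mem, fun a b => by simp [one_mem]⟩
  · intro k l hkl c β ih u hu
    set φ := mapRingHom (algebraMap R L) with hφ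
    obtain ⟨r, hr, c', hc⟩ := exists_smul_eq_map M c
    rw [← hφ] at hc
    obtain ⟨s, hs, hsβ⟩ := ih (u * r * (u * r)) (by simp [mul_mem, hu, hr])
    refine ⟨u * r * s, by simp [mul_mem, hu, hr, hs], fun a b => ?_⟩
    have hcomp : ∀ a : R[X], φ (C r) * c.comp (φ a) = φ (c'.comp a) := fun a => by
      have := congrArg (fun p => p.comp (φ a)) hc
      simpa [hφ, Polynomial.map_comp] using this
    have hunit : IsUnit (φ (C r)) := by
      have := (IsLocalization.map_units L (⟨r, hr⟩ : M)).map (C : L →+* L[X])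
      simpa [hφ] using this
    simp only [map_mul, map_transvection, _root_.mul_inv_rev, coe_compRingHom_apply]
    have h1 : SpecialLinearGroup.transvection hkl (c.comp (φ (a + C u * C r * C s * b))) *
        (SpecialLinearGroup.transvection hkl (c.comp (φ a)))⁻¹ ∈ elemOf ι φ (C u) := by
      rw [transvection_inv, ← transvection_add]
      apply transvection_mem_elemOf
      obtain ⟨q, hq⟩ : (a + C u * C r * C s * b) - a ∣
        c'.comp (a + C u * C r * C s * b) - c'.comp a := by
          have := sub_dvd_eval_sub (a + C u * C r * C s * b) a (c'.map C)
          rwa [← eval₂_eq_eval_map, ← eval₂_eq_eval_map] at this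
      refine ⟨C s * b * q, hunit.mul_left_cancel ?_⟩
      rw [mul_add, mul_neg, hcomp, hcomp, ← sub_eq_add_neg, ← map_sub, hq]
      simp only [map_mul, map_sub, map_add]
      ring
    have h2 := hsβ a (C u * C r * b)
    have e : C s * (C u * C r * b) = C u * C r * C s * b := by ring
    rw [e] at h2
    have h2' := conj_mem_elemOf hι φ (C u) (C r) (c.comp (φ a)) (c'.comp a) (hcomp a) hkl
      (by simpa using h2)
    have := mul_mem h1 h2'
    convert this using 1
    simp [mul_assoc]

theorem coe_mul_mul (ε δ : SpecialLinearGroup ι R) (F : Matrix ι κ R) :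
    ((ε * δ : SpecialLinearGroup ι R) : Matrix ι ι R) * F =
      (ε : Matrix ι ι R) * ((δ : Matrix ι ι R) * F) :=
  Matrix.mul_assoc _ _ _

theorem exists_elem_mul_eq_eval_zero (hι : 3 ≤ Fintype.card ι) [IsDomain R]
    (F : Matrix ι κ R[X])
    (h : ∀ (M : Ideal R) [M.IsMaximal], ∃ β ∈ elem ι (Localization.AtPrime M)[X],
      ∃ D : Matrix ι κ (Localization.AtPrime M),
        F.map (mapRingHom (algebraMap R (Localization.AtPrime M))) =
          (β : Matrix ι ι (Localization.AtPrime M)[X]) * D.map C) :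
    ∃ ε ∈ elem ι R[X], (ε : Matrix ι ι R[X]) * F = (F.map (eval 0)).map C := by
  let J : Ideal R :=
    { carrier := {s | ∀ a b : R[X], ∃ ε ∈ elem ι R[X],
        (ε : Matrix ι ι R[X]) * F.map (fun p => p.comp a) =
          F.map (fun p => p.comp (a + C s * b))}
      add_mem' := by
        intro s s' hs hs' a b
        obtain ⟨ε, hε, h1⟩ := hs a b
        obtain ⟨ε', hε', h2⟩ := hs' (a + C s * b) b
        refine ⟨ε' * ε, mul_mem hε' hε, ?_⟩
        rw [coe_mul_mul, h1, h2]
        simp [add_mul, add_assoc]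
      zero_mem' := fun a b => ⟨1, one_mem _, by simp⟩
      smul_mem' := by
        intro r s hs a b
        obtain ⟨ε, hε, h1⟩ := hs a (C r * b)
        refine ⟨ε, hε, ?_⟩
        rw [h1]
        congr 1; funext p; congr 2
        simp only [smul_eq_mul, C_mul]; ring }
  have hJ : J = ⊤ := by
    by_contra hne
    obtain ⟨M, hM, hJM⟩ := Ideal.exists_le_maximal J hne
    obtain ⟨β, hβ, D, hD⟩ := h M
    obtain ⟨t, ht, hβt⟩ := exists_translate_mem_elemOf hι M.primeCompl hβ 1 (one_mem _)
    refine ht (hJM fun a b => ?_)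
    set φ := mapRingHom (algebraMap R (Localization.AtPrime M)) with hφ
    have hφi : Function.Injective φ := by
      apply Polynomial.map_injective
      exact IsLocalization.injective _ M.primeCompl_le_nonZeroDivisors
    obtain ⟨ε, hε, hεβ⟩ := elemOf_le_map _ _ (hβt a b)
    refine ⟨ε, hε, ?_⟩
    have hF : ∀ a : R[X], (F.map (fun p => p.comp a)).map φ =
        (SpecialLinearGroup.map (compRingHom (φ a)) β : Matrix ι ι _) * D.map C := by
      intro a
      have := congrArg (fun N => N.map (compRingHom (φ a))) hD
      simp only [Matrix.map_mul] at this
      have e1 : (F.map (fun p => p.comp a)).map φ = (F.map φ).map (compRingHom (φ a)) := by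
        ext i j : 2
        simp [hφ, Polynomial.map_comp]
      have e2 : (D.map C).map (compRingHom (φ a)) = D.map C := by
        ext i j : 2
        simp
      rw [e1, this, e2]
      rfl
    have hinj : Function.Injective (fun N : Matrix ι κ R[X] => N.map φ) :=
      Matrix.map_injective hφi
    apply hinj
    change (_ * _ : Matrix _ _ _).map φ = _
    rw [Matrix.map_mul, hF a]
    change _ = (F.map (fun p => p.comp (a + C t * b))).map φ
    rw [hF]
    refine (coe_mul_mul (SpecialLinearGroup.map φ ε) _ _).symm.trans ?_
    rw [hεβ, inv_mul_cancel_right]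
    rfl
  have h1 : (1 : R) ∈ J := hJ ▸ Submodule.mem_top
  obtain ⟨ε, hε, h2⟩ := h1 X (-X)
  refine ⟨ε, hε, ?_⟩
  convert h2 using 1
  · congr 1
    ext i j : 2
    simp
  · ext i j : 2
    simp [Polynomial.comp_zero]

end Patching
end SuslinStability

namespace SuslinStability
open Matrix.SpecialLinearGroup Polynomial

section Columns

variable {ι : Type*} [DecidableEq ι] [Fintype ι] {R S : Type*} [CommRing R] [CommRing S]

/-- Two columns are related if an elementary matrix moves one to the other. -/
def ElemRel (f g : ι → R) : Prop := ∃ ε ∈ elem ι R, ε • f = g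

/-- A column is unimodular if its entries generate the unit ideal. -/
def Unimodular (f : ι → R) : Prop := ∃ g : ι → R, g ⬝ᵥ f = 1

theorem ElemRel.refl (f : ι → R) : ElemRel f f := ⟨1, one_mem _, one_smul _ f⟩

theorem ElemRel.trans {f g h : ι → R} : ElemRel f g → ElemRel g h → ElemRel f h := by
  rintro ⟨ε, hε, rfl⟩ ⟨δ, hδ, rfl⟩
  exact ⟨δ * ε, mul_mem hδ hε, mul_smul _ _ _⟩

theorem ElemRel.map (φ : R →+* S) {f g : ι → R} (h : ElemRel f g) :
    ElemRel (fun i => φ (f i)) (fun i => φ (g i)) := by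
  obtain ⟨ε, hε, rfl⟩ := h
  refine ⟨_, map_mem_elem φ hε, ?_⟩
  funext i
  exact (RingHom.map_mulVec φ ε.1 f i).symm

omit [DecidableEq ι] in
theorem Unimodular.map (φ : R →+* S) {f : ι → R} (h : Unimodular f) :
    Unimodular (fun i => φ (f i)) := by
  obtain ⟨g, hg⟩ := h
  refine ⟨fun i => φ (g i), ?_⟩
  have := congrArg φ hg
  rwa [RingHom.map_dotProduct, map_one] at this

theorem Unimodular.of_elemRel {f g : ι → R} (h : ElemRel f g) (hf : Unimodular f) :
    Unimodular g := by
  obtain ⟨ε, hε, rfl⟩ := h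
  obtain ⟨v, hv⟩ := hf
  refine ⟨v ᵥ* (ε⁻¹).1, ?_⟩
  rw [← dotProduct_mulVec]
  have : (ε⁻¹).1 *ᵥ (ε • f) = f := inv_smul_smul ε f
  rw [this, hv]

theorem elemRel_update (f : ι → R) {i j : ι} (h : i ≠ j) (c : R) :
    ElemRel f (Function.update f i (f i + c * f j)) := by
  refine ⟨_, transvection_mem_elem h c, ?_⟩
  change (1 + Matrix.single i j c) *ᵥ f = _
  rw [add_mulVec, one_mulVec, single_mulVec_eq]
  funext a
  by_cases ha : a = i
  · subst ha; simp
  · simp [ha]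

theorem elemRel_add_mul (f : ι → R) (i : ι) (c : ι → R) (hc : c i = 0) :
    ElemRel f (fun j => f j + c j * f i) := by
  have key : ∀ s : Finset ι, ElemRel f (fun j => if j ∈ s then f j + c j * f i else f j) := by
    intro s
    induction s using Finset.induction_on with
    | empty => simpa using ElemRel.refl f
    | insert a s ha ih =>
      by_cases hai : a = i
      · subst hai
        convert ih using 2 with j
        by_cases hj : j = a
        · subst hj; simp [hc]
        · simp [hj]
      · refine ih.trans ?_
        convert elemRel_update _ hai (c a) using 1
        funext j
        by_cases hj : j = a
        · subst hj; simp [ha, hc]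
        · simp [hj]
  simpa using key Finset.univ

theorem elemRel_single_of_eq_one {f : ι → R} {i : ι} (h : f i = 1) :
    ElemRel f (Pi.single i 1) := by
  convert elemRel_add_mul f i (fun j => if j = i then 0 else - f j) (by simp) using 1
  funext j
  by_cases hj : j = i
  · subst hj; simp [h]
  · simp [hj, h]

theorem elemRel_single_of_isUnit [Nontrivial ι] {f : ι → R} {j : ι} (h : IsUnit (f j)) (i : ι) :
    ElemRel f (Pi.single i 1) := by
  have key : ∀ (f : ι → R) (j i : ι), j ≠ i → IsUnit (f j) → ElemRel f (Pi.single i 1) := by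
    intro f j i hji hf
    obtain ⟨u, hu⟩ := hf
    refine (elemRel_update f hji.symm ((1 - f i) * ↑u⁻¹)).trans (elemRel_single_of_eq_one ?_)
    simp [← hu]
  by_cases hji : j = i
  · subst hji
    obtain ⟨p, hp⟩ := exists_ne j
    refine (key f j p hp.symm h).trans (key _ p j hp ?_)
    simp
  · exact key f j i hji h

end Columns

section Local

variable {ι : Type*} [DecidableEq ι] [Fintype ι] {R : Type*} [CommRing R]

theorem exists_combination_monic [IsLocalRing R] {P : R[X]} (hP : P.Monic) {d : ℕ}
    (hd : P.natDegree = d + 1) (Q : R[X]) (hQ : Q.natDegree ≤ d) (n : ℕ)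
    (hn : IsUnit (Q.coeff n)) :
    ∃ a b : R[X], (a * P + b * Q).natDegree ≤ d ∧ (a * P + b * Q).coeff d = 1 := by
  have unit_case : ∀ Q : R[X], Q.natDegree ≤ d → IsUnit (Q.coeff d) →
      ∃ a b : R[X], (a * P + b * Q).natDegree ≤ d ∧ (a * P + b * Q).coeff d = 1 := by
    rintro Q hQ ⟨u, hu⟩
    refine ⟨0, C ↑u⁻¹, ?_, ?_⟩
    · rw [zero_mul, zero_add]
      exact (natDegree_C_mul_le _ _).trans hQ
    · simp [← hu]
  have hnd : n ≤ d := by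
    by_contra hlt
    rw [coeff_eq_zero_of_natDegree_lt (by omega)] at hn
    exact not_isUnit_zero hn
  obtain ⟨m, hm⟩ : ∃ m, n + m = d := ⟨d - n, by omega⟩
  induction m generalizing n Q with
  | zero =>
    obtain rfl : n = d := by omega
    exact unit_case Q hQ hn
  | succ m ih =>
    by_cases hu : IsUnit (Q.coeff d)
    · exact unit_case Q hQ hu
    have hQ' : (X * Q - C (Q.coeff d) * P).natDegree ≤ d := by
      rw [natDegree_le_iff_coeff_eq_zero]
      intro N hN
      obtain ⟨N, rfl⟩ : ∃ K, N = K + 1 := ⟨N - 1, by omega⟩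
      rw [coeff_sub, coeff_X_mul, coeff_C_mul]
      rcases Nat.lt_or_ge d N with h | h
      · rw [coeff_eq_zero_of_natDegree_lt (p := Q) (by omega),
          coeff_eq_zero_of_natDegree_lt (p := P) (by omega)]
        simp
      · obtain rfl : N = d := by omega
        have : P.coeff (N + 1) = 1 := by rw [← hd]; exact hP
        rw [this, mul_one, sub_self]
    have hc : IsUnit ((X * Q - C (Q.coeff d) * P).coeff (n + 1)) := by
      rw [coeff_sub, coeff_X_mul, coeff_C_mul]
      by_contra hnon
      have h1 : Q.coeff d * P.coeff (n + 1) ∈ nonunits R :=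
        fun h => hu (isUnit_of_mul_isUnit_left h)
      have := IsLocalRing.nonunits_add hnon h1
      rw [sub_add_cancel] at this
      exact this hn
    obtain ⟨a, b, h1, h2⟩ := ih _ hQ' (n + 1) hc (by omega) (by omega)
    have e : (a - b * C (Q.coeff d)) * P + (b * X) * Q =
      a * P + b * (X * Q - C (Q.coeff d) * P) := by ring
    exact ⟨_, _, by rw [e]; exact h1, by rw [e]; exact h2⟩

/-- Over a local ring, a unimodular column of polynomials with a monic entry can be reduced
to a basis vector by elementary operations. -/
theorem elemRel_single_of_monic_local [IsLocalRing R] (hι : 3 ≤ Fintype.card ι) (i₀ : ι)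
    (d : ℕ) (f : ι → R[X]) (i : ι) (hd : (f i).natDegree = d) (hi : (f i).Monic)
    (hf : Unimodular f) : ElemRel f (Pi.single i₀ 1) := by
  have : Nontrivial ι := Fintype.one_lt_card_iff_nontrivial.1 (by omega)
  induction d generalizing f i with
  | zero =>
    have : f i = 1 := hi.natDegree_eq_zero.1 hd
    exact elemRel_single_of_isUnit (j := i) (by simp [this]) i₀
  | succ d ih =>
    set f' : ι → R[X] := fun j => f j + (if j = i then 0 else -(f j /ₘ f i)) * f i with hf'
    have hrel : ElemRel f f' := elemRel_add_mul f i _ (by simp)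
    have hf'u : Unimodular f' := hf.of_elemRel hrel
    have hi' : f' i = f i := by simp [hf']
    have hmod : ∀ j, j ≠ i → f' j = f j %ₘ f i := by
      intro j hj
      have := modByMonic_add_div (f j) (f i)
      simp only [hf', hj, if_false]
      linear_combination -this
    have hne1 : f i ≠ 1 := fun h => by rw [h] at hd; simp at hd
    have hdeg : ∀ j, j ≠ i → (f' j).natDegree ≤ d := by
      intro j hj
      rw [hmod j hj]
      have := natDegree_modByMonic_lt (f j) hi hne1
      omega
    obtain ⟨j, hj, n, hn⟩ : ∃ j, j ≠ i ∧ ∃ n, IsUnit ((f' j).coeff n) := by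
      by_contra! hcon
      obtain ⟨g, hg⟩ := hf'u.map (mapRingHom (IsLocalRing.residue R))
      have hz : ∀ j, j ≠ i → mapRingHom (IsLocalRing.residue R) (f' j) = 0 := by
        intro j hj
        ext n
        have := hcon j hj n
        rw [coe_mapRingHom, coeff_map, coeff_zero, IsLocalRing.residue_eq_zero_iff]
        exact (IsLocalRing.mem_maximalIdeal _).2 this
      rw [dotProduct, Finset.sum_eq_single i (fun j _ hj => by rw [hz j hj, mul_zero])
        (by simp)] at hg
      have hu : IsUnit ((f i).map (IsLocalRing.residue R)) := by
        rw [hi'] at hg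
        exact IsUnit.of_mul_eq_one_right _ hg
      have := natDegree_eq_zero_of_isUnit hu
      rw [hi.natDegree_map, hd] at this
      omega
    obtain ⟨p, hpi, hpj⟩ := exists_ne_ne hι i j
    obtain ⟨a, b, hab, hab1⟩ := exists_combination_monic (hi' ▸ hi) (hi' ▸ hd) (f' j)
      (hdeg j hj) n hn
    set c : R[X] := C (1 - (f' p).coeff d) with hc
    have h1 := elemRel_update f' hpi (c * a)
    set f₁ := Function.update f' p (f' p + c * a * f' i) with hf₁
    have h2 := elemRel_update f₁ hpj (c * b)
    set f₂ := Function.update f₁ p (f₁ p + c * b * f₁ j) with hf₂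
    have hrel2 : ElemRel f f₂ := (hrel.trans h1).trans h2
    have hf₂p : f₂ p = f' p + c * (a * f' i + b * f' j) := by
      simp only [hf₂, hf₁, Function.update_self, Function.update_of_ne hpj.symm]
      ring
    have hdeg2 : (f₂ p).natDegree ≤ d := by
      rw [hf₂p]
      exact natDegree_add_le_of_degree_le (hdeg p hpi) ((natDegree_C_mul_le _ _).trans hab)
    have hcoeff : (f₂ p).coeff d = 1 := by
      rw [hf₂p, coeff_add, hc, coeff_C_mul, hab1]
      ring
    have hmonic := monic_of_natDegree_le_of_coeff_eq_one d hdeg2 hcoeff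
    refine hrel2.trans (ih f₂ p ?_ hmonic (hf.of_elemRel hrel2))
    exact natDegree_eq_of_le_of_coeff_ne_zero hdeg2 (by rw [hcoeff]; exact one_ne_zero)

end Local

section Global

variable {ι : Type*} [DecidableEq ι] [Fintype ι] {R : Type*} [CommRing R] [IsDomain R]

theorem elemRel_single_of_monic (hι : 3 ≤ Fintype.card ι) (i₀ : ι)
    (hR : ∀ v : ι → R, Unimodular v → ElemRel v (Pi.single i₀ 1))
    (f : ι → R[X]) (i : ι) (hi : (f i).Monic) (hf : Unimodular f) :
    ElemRel f (Pi.single i₀ 1) := by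
  obtain ⟨ε, hε, h⟩ := exists_elem_mul_eq_eval_zero hι (Matrix.of fun a (_ : Unit) => f a) (by
    intro M hM
    obtain ⟨β, hβ, h⟩ := elemRel_single_of_monic_local hι i₀ _
      (fun a => mapRingHom (algebraMap R (Localization.AtPrime M)) (f a)) i rfl (hi.map _)
      (hf.map _)
    refine ⟨β⁻¹, inv_mem hβ, Matrix.of fun a _ => (Pi.single i₀ 1 : ι → _) a, ?_⟩
    rw [← eq_inv_smul_iff] at h
    ext1 a u
    refine (congrFun h a).trans ?_
    change ((β⁻¹).1 *ᵥ _) a = ((β⁻¹).1 *ᵥ _) a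
    congr 2
    funext b
    by_cases hb : b = i₀
    · subst hb; simp
    · simp [hb])
  have h1 : ElemRel f (fun a => C ((f a).eval 0)) :=
    ⟨ε, hε, funext fun a => congrFun (congrFun h a) ()⟩
  have h2 := (hR _ (hf.map (evalRingHom 0))).map C
  refine h1.trans ?_
  have e : (Pi.single i₀ 1 : ι → R[X]) = fun b => C ((Pi.single i₀ 1 : ι → R) b) := by
    funext b
    by_cases hb : b = i₀
    · subst hb; simp
    · simp [hb]
  rw [e]
  exact h2

end Global
end SuslinStability

namespace SuslinStability
open Matrix.SpecialLinearGroup Polynomial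

section ElementaryMatrices

variable {ι : Type*} [DecidableEq ι] [Fintype ι] {R S : Type*} [CommRing R] [CommRing S]

/-- A matrix is elementary if it is a product of elementary matrices. -/
def IsElem (M : Matrix ι ι R) : Prop := ∃ g ∈ elem ι R, (g : Matrix ι ι R) = M

theorem IsElem.one : IsElem (1 : Matrix ι ι R) := ⟨1, one_mem _, rfl⟩

theorem IsElem.mul {M N : Matrix ι ι R} : IsElem M → IsElem N → IsElem (M * N) := by
  rintro ⟨g, hg, rfl⟩ ⟨h, hh, rfl⟩
  exact ⟨g * h, mul_mem hg hh, rfl⟩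

theorem IsElem.transvection {i j : ι} (h : i ≠ j) (c : R) :
    IsElem (Matrix.transvection i j c) := ⟨_, transvection_mem_elem h c, rfl⟩

theorem IsElem.map (φ : R →+* S) {M : Matrix ι ι R} : IsElem M → IsElem (M.map φ) := by
  rintro ⟨g, hg, rfl⟩
  exact ⟨_, map_mem_elem φ hg, rfl⟩

theorem IsElem.of_transvection_mul {i j : ι} (h : i ≠ j) (c : R) {M : Matrix ι ι R}
    (hM : IsElem (Matrix.transvection i j c * M)) : IsElem M := by
  have := (IsElem.transvection h (-c)).mul hM
  rwa [← Matrix.mul_assoc, transvection_mul_transvection_same i j h, neg_add_cancel,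
    transvection_zero, Matrix.one_mul] at this

theorem IsElem.of_mul_transvection {i j : ι} (h : i ≠ j) (c : R) {M : Matrix ι ι R}
    (hM : IsElem (M * Matrix.transvection i j c)) : IsElem M := by
  have := hM.mul (IsElem.transvection h (-c))
  rwa [Matrix.mul_assoc, transvection_mul_transvection_same i j h, add_neg_cancel,
    transvection_zero, Matrix.mul_one] at this

end ElementaryMatrices

section Mennicke

variable {R S : Type*} [CommRing R] [CommRing S]

/-- The matrix `(a b; c d) ⊕ 1` is a product of elementary `3 × 3` matrices. -/
def StablyElem (a b c d : R) : Prop := IsElem !![a, b, 0; c, d, 0; 0, 0, 1]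

theorem StablyElem.of_row₁ (t : R) {a b c d : R}
    (h : StablyElem (a + t * c) (b + t * d) c d) : StablyElem a b c d := by
  refine IsElem.of_transvection_mul (i := 0) (j := 1) (by decide) t ?_
  refine Eq.mp (congrArg IsElem ?_) h
  ext i j
  fin_cases i <;> fin_cases j <;>
    simp [Matrix.mul_apply, Fin.sum_univ_three, Matrix.transvection, Matrix.single, one_apply]

theorem StablyElem.of_row₂ (t : R) {a b c d : R}
    (h : StablyElem a b (c + t * a) (d + t * b)) : StablyElem a b c d := by
  refine IsElem.of_transvection_mul (i := 1) (j := 0) (by decide) t ?_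
  refine Eq.mp (congrArg IsElem ?_) h
  ext i j
  fin_cases i <;> fin_cases j <;>
    simp [Matrix.mul_apply, Fin.sum_univ_three, Matrix.transvection, Matrix.single, one_apply,
      add_comm]

theorem StablyElem.of_col₁ (t : R) {a b c d : R}
    (h : StablyElem (a + t * b) b (c + t * d) d) : StablyElem a b c d := by
  refine IsElem.of_mul_transvection (i := 1) (j := 0) (by decide) t ?_
  refine Eq.mp (congrArg IsElem ?_) h
  ext i j
  fin_cases i <;> fin_cases j <;>
    simp [Matrix.mul_apply, Fin.sum_univ_three, Matrix.transvection, Matrix.single, one_apply,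
      mul_comm t]

theorem StablyElem.of_col₂ (t : R) {a b c d : R}
    (h : StablyElem a (b + t * a) c (d + t * c)) : StablyElem a b c d := by
  refine IsElem.of_mul_transvection (i := 0) (j := 1) (by decide) t ?_
  refine Eq.mp (congrArg IsElem ?_) h
  ext i j
  fin_cases i <;> fin_cases j <;>
    simp [Matrix.mul_apply, Fin.sum_univ_three, Matrix.transvection, Matrix.single, one_apply,
      mul_comm t, add_comm]

theorem StablyElem.of_isUnit_right {a b c d : R} (hdet : a * d - b * c = 1) (hb : IsUnit b) :
    StablyElem a b c d := by
  obtain ⟨u, rfl⟩ := hb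
  refine StablyElem.of_col₁ ((1 - a) * ↑u⁻¹) (StablyElem.of_col₂ (-(u : R)) ?_)
  refine StablyElem.of_row₂ (-(c + (1 - a) * ↑u⁻¹ * d)) ?_
  have hu : (↑u⁻¹ : R) * u = 1 := u.inv_mul
  have e : !![a + (1 - a) * ↑u⁻¹ * ↑u, ↑u + -↑u * (a + (1 - a) * ↑u⁻¹ * ↑u), 0;
      c + (1 - a) * ↑u⁻¹ * d + -(c + (1 - a) * ↑u⁻¹ * d) * (a + (1 - a) * ↑u⁻¹ * ↑u),
      d + -↑u * (c + (1 - a) * ↑u⁻¹ * d) + -(c + (1 - a) * ↑u⁻¹ * d) *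
        (↑u + -↑u * (a + (1 - a) * ↑u⁻¹ * ↑u)), 0; 0, 0, 1] =
      (1 : Matrix (Fin 3) (Fin 3) R) := by
    have h1 : a + (1 - a) * ↑u⁻¹ * ↑u = 1 := by linear_combination (1 - a) * hu
    rw [h1]
    ext i j
    fin_cases i <;> fin_cases j <;> simp
    linear_combination hdet - (1 - a) * d * hu
  rw [StablyElem, e]
  exact IsElem.one

theorem StablyElem.of_isUnit_left {a b c d : R} (hdet : a * d - b * c = 1) (ha : IsUnit a) :
    StablyElem a b c d := by
  obtain ⟨u, rfl⟩ := ha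
  refine StablyElem.of_col₂ ((1 - b) * ↑u⁻¹) (StablyElem.of_isUnit_right ?_ ?_)
  · linear_combination hdet
  · simp

theorem isElem_weyl : IsElem (!![1, 0, 0; 0, 0, 1; 0, -1, 0] : Matrix (Fin 3) (Fin 3) R) := by
  convert ((IsElem.transvection (i := (1 : Fin 3)) (j := 2) (by decide) (1 : R)).mul
    (IsElem.transvection (i := (2 : Fin 3)) (j := 1) (by decide) (-1 : R))).mul
    (IsElem.transvection (i := (1 : Fin 3)) (j := 2) (by decide) (1 : R)) using 1
  ext i j
  fin_cases i <;> fin_cases j <;>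
    simp [Matrix.mul_apply, Fin.sum_univ_three, Matrix.transvection, Matrix.single, one_apply]

theorem isElem_weyl_inv : IsElem (!![1, 0, 0; 0, 0, -1; 0, 1, 0] : Matrix (Fin 3) (Fin 3) R) := by
  convert ((IsElem.transvection (i := (1 : Fin 3)) (j := 2) (by decide) (-1 : R)).mul
    (IsElem.transvection (i := (2 : Fin 3)) (j := 1) (by decide) (1 : R))).mul
    (IsElem.transvection (i := (1 : Fin 3)) (j := 2) (by decide) (-1 : R)) using 1
  ext i j
  fin_cases i <;> fin_cases j <;>
    simp [Matrix.mul_apply, Fin.sum_univ_three, Matrix.transvection, Matrix.single, one_apply]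

/-- Multiplicativity of the Mennicke symbol. -/
theorem StablyElem.mul {a a' b c d : R} (hdet : a * a' * d - b * c = 1)
    (h : StablyElem a b c (a' * d)) (h' : StablyElem a' b c (a * d)) :
    StablyElem (a * a') b c d := by
  have hB : IsElem !![a', 0, b; 0, 1, 0; c, 0, a * d] := by
    convert (IsElem.mul isElem_weyl_inv h').mul isElem_weyl using 1
    simp
  refine IsElem.of_mul_transvection (i := 1) (j := 2) (by decide) a ?_
  have hW := ((isElem_weyl (R := R)).mul
    (IsElem.transvection (i := 1) (j := 2) (by decide) (-a'))).mul
    ((IsElem.transvection (i := 2) (j := 0) (by decide) (-(c * d))).mul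
    (IsElem.transvection (i := 2) (j := 1) (by decide) (a * d)))
  convert hW.mul (IsElem.mul h hB) using 1
  have t12 : ∀ x : R, Matrix.transvection (1 : Fin 3) 2 x = !![1, 0, 0; 0, 1, x; 0, 0, 1] := by
    intro x; ext i j
    fin_cases i <;> fin_cases j <;> simp [Matrix.transvection, Matrix.single, one_apply]
  have t20 : ∀ x : R, Matrix.transvection (2 : Fin 3) 0 x = !![1, 0, 0; 0, 1, 0; x, 0, 1] := by
    intro x; ext i j
    fin_cases i <;> fin_cases j <;> simp [Matrix.transvection, Matrix.single, one_apply]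
  have t21 : ∀ x : R, Matrix.transvection (2 : Fin 3) 1 x = !![1, 0, 0; 0, 1, 0; 0, x, 1] := by
    intro x; ext i j
    fin_cases i <;> fin_cases j <;> simp [Matrix.transvection, Matrix.single, one_apply]
  rw [t12, t12, t20, t21]
  ext i j
  fin_cases i <;> fin_cases j <;> simp <;> first
    | ring1
    | linear_combination -d * hdet
    | linear_combination -(a' * d) * hdet
    | linear_combination -hdet

end Mennicke

section Local

variable {R : Type*} [CommRing R]

theorem stablyElem_of_monic_of_isUnit [IsLocalRing R] {d : ℕ}
    (ih : ∀ p q r s : R[X], p.natDegree = d → p.Monic → p * s - q * r = 1 → StablyElem p q r s)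
    (p q r s : R[X]) (hd : p.natDegree = d + 1) (hp : p.Monic) (hdet : p * s - q * r = 1)
    (hq : q.natDegree ≤ d) (hu : IsUnit (q.coeff 0)) : StablyElem p q r s := by
  obtain ⟨u, hu⟩ := hu
  set t : R[X] := C (-(p.coeff 0 * ↑u⁻¹)) with ht
  refine StablyElem.of_col₁ t ?_
  have hdeg : (t * q).degree < p.degree := by
    rw [degree_eq_natDegree hp.ne_zero, hd]
    refine lt_of_le_of_lt (degree_le_of_natDegree_le ((natDegree_C_mul_le _ _).trans hq)) ?_
    exact_mod_cast Nat.lt_succ_self d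
  have hm : (p + t * q).Monic := hp.add_of_left hdeg
  have hnd : (p + t * q).natDegree = d + 1 := by
    rw [natDegree_add_eq_left_of_degree_lt hdeg, hd]
  have h0 : (p + t * q).coeff 0 = 0 := by
    rw [coeff_add, ht, coeff_C_mul, ← hu]
    have : (↑u⁻¹ : R) * u = 1 := u.inv_mul
    linear_combination - p.coeff 0 * this
  obtain ⟨p', hp'⟩ := X_dvd_iff.2 h0
  have hp'm : p'.Monic := by
    rw [hp'] at hm
    exact Monic.of_mul_monic_left monic_X hm
  have hp'd : p'.natDegree = d := by
    rw [hp', natDegree_X_mul hp'm.ne_zero] at hnd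
    omega
  have hdet' : X * p' * s - q * (r + t * s) = 1 := by
    rw [← hp']; linear_combination hdet
  rw [hp']
  refine StablyElem.mul hdet' ?_ (ih _ _ _ _ hp'd hp'm (by linear_combination hdet'))
  obtain ⟨q₁, hq₁⟩ : X ∣ q - C (q.coeff 0) := X_dvd_iff.2 (by simp)
  refine StablyElem.of_col₂ (-q₁) (StablyElem.of_isUnit_right ?_ ?_)
  · linear_combination hdet'
  · have : q + -q₁ * X = C (q.coeff 0) := by linear_combination hq₁
    rw [this, ← hu]
    exact u.isUnit.map C

/-- Over a local ring, an element of `SL₂` of the polynomial ring with a monic entry is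
stably elementary. -/
theorem stablyElem_of_monic_local [IsLocalRing R] (d : ℕ) (p q r s : R[X])
    (hd : p.natDegree = d) (hp : p.Monic) (hdet : p * s - q * r = 1) : StablyElem p q r s := by
  induction d generalizing p q r s with
  | zero =>
    have : p = 1 := hp.natDegree_eq_zero.1 hd
    exact StablyElem.of_isUnit_left hdet (by simp [this])
  | succ d ih =>
    have hne1 : p ≠ 1 := fun h => by rw [h] at hd; simp at hd
    have key : ∀ f : R[X], (f + -(f /ₘ p) * p).natDegree ≤ d := by
      intro f
      have h1 := modByMonic_add_div f p
      have h2 : f + -(f /ₘ p) * p = f %ₘ p := by linear_combination -h1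
      rw [h2]
      have := natDegree_modByMonic_lt f hp hne1
      omega
    refine StablyElem.of_col₂ (-(q /ₘ p)) ?_
    have hq := key q
    have hdet1 : p * (s + -(q /ₘ p) * r) - (q + -(q /ₘ p) * p) * r = 1 := by
      linear_combination hdet
    generalize q + -(q /ₘ p) * p = q' at *
    generalize s + -(q /ₘ p) * r = s' at *
    by_cases hu : IsUnit (q'.coeff 0)
    · exact stablyElem_of_monic_of_isUnit ih p q' r s' hd hp hdet1 hq hu
    refine StablyElem.of_row₂ (-(r /ₘ p)) ?_
    have hr := key r
    have hdet2 : p * (s' + -(r /ₘ p) * q') - q' * (r + -(r /ₘ p) * p) = 1 := by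
      linear_combination hdet1
    generalize r + -(r /ₘ p) * p = r' at *
    generalize s' + -(r /ₘ p) * q' = s'' at *
    have hs : s''.natDegree ≤ d := by
      by_cases h0 : s'' = 0
      · simp [h0]
      have h1 : (p * s'').natDegree ≤ d + d := by
        have e : p * s'' = 1 + q' * r' := by linear_combination hdet2
        rw [e]
        refine natDegree_add_le_of_degree_le (by simp) ?_
        exact natDegree_mul_le_of_le hq hr
      rw [hp.natDegree_mul' h0] at h1
      omega
    refine StablyElem.of_row₁ 1 ?_
    simp only [one_mul]
    have hdeg : r'.degree < p.degree := by
      rw [degree_eq_natDegree hp.ne_zero, hd]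
      refine lt_of_le_of_lt (degree_le_of_natDegree_le hr) ?_
      exact_mod_cast Nat.lt_succ_self d
    refine stablyElem_of_monic_of_isUnit ih _ _ _ _ ?_ (hp.add_of_left hdeg)
      (by linear_combination hdet2) (natDegree_add_le_of_degree_le hq hs) ?_
    · rw [natDegree_add_eq_left_of_degree_lt hdeg, hd]
    · have hs0 : IsUnit (s''.coeff 0) := by
        have h0 := congrArg (fun f => f.coeff 0) hdet2
        simp only [coeff_sub, mul_coeff_zero, coeff_one_zero] at h0
        by_contra hnon
        have h1 : p.coeff 0 * s''.coeff 0 ∈ nonunits R :=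
          fun h => hnon (isUnit_of_mul_isUnit_right h)
        have h2 : -(q'.coeff 0 * r'.coeff 0) ∈ nonunits R :=
          fun h => hu (isUnit_of_mul_isUnit_left ((IsUnit.neg_iff _).1 h))
        have h3 := IsLocalRing.nonunits_add h1 h2
        rw [← sub_eq_add_neg, h0] at h3
        exact h3 isUnit_one
      rw [coeff_add]
      by_contra hnon
      have h2 : -q'.coeff 0 ∈ nonunits R := fun h => hu ((IsUnit.neg_iff _).1 h)
      have h3 := IsLocalRing.nonunits_add hnon h2
      rw [add_neg_cancel_comm] at h3
      exact h3 hs0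

end Local

section Global

variable {R S : Type*} [CommRing R] [CommRing S]

theorem StablyElem.map (φ : R →+* S) {a b c d : R} (h : StablyElem a b c d) :
    StablyElem (φ a) (φ b) (φ c) (φ d) := by
  refine Eq.mp (congrArg IsElem ?_) (IsElem.map φ h)
  ext i j
  fin_cases i <;> fin_cases j <;> simp

theorem stablyElem_of_monic [IsDomain R]
    (hR : ∀ a b c d : R, a * d - b * c = 1 → StablyElem a b c d)
    (p q r s : R[X]) (hp : p.Monic) (hdet : p * s - q * r = 1) : StablyElem p q r s := by
  obtain ⟨ε, hε, h⟩ := exists_elem_mul_eq_eval_zero (by simp)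
      !![p, q, 0; r, s, 0; 0, 0, 1] (by
    intro M hM
    set φ := mapRingHom (algebraMap R (Localization.AtPrime M)) with hφ
    obtain ⟨β, hβ, h⟩ := stablyElem_of_monic_local _ (φ p) (φ q) (φ r) (φ s) rfl (hp.map _) (by
      rw [← map_mul, ← map_mul, ← map_sub, hdet, map_one])
    refine ⟨β, hβ, 1, ?_⟩
    rw [Matrix.map_one _ (map_zero C) (map_one C), Matrix.mul_one, h]
    ext1 i j
    fin_cases i <;> fin_cases j <;> simp)
  have h0 : StablyElem (C (p.eval 0)) (C (q.eval 0)) (C (r.eval 0)) (C (s.eval 0)) := by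
    refine (hR _ _ _ _ ?_).map C
    have := congrArg (eval 0) hdet
    simpa using this
  have h1 : (ε : Matrix (Fin 3) (Fin 3) R[X]) * !![p, q, 0; r, s, 0; 0, 0, 1] =
      !![C (p.eval 0), C (q.eval 0), 0; C (r.eval 0), C (s.eval 0), 0; 0, 0, 1] := by
    rw [h]
    ext1 i j
    fin_cases i <;> fin_cases j <;> simp
  obtain ⟨δ, hδ, h2⟩ := h0
  refine ⟨ε⁻¹ * δ, mul_mem (inv_mem hε) hδ, ?_⟩
  have h3 : (δ : Matrix (Fin 3) (Fin 3) R[X]) =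
      (ε : Matrix (Fin 3) (Fin 3) R[X]) * !![p, q, 0; r, s, 0; 0, 0, 1] := h2.trans h1.symm
  have h4 : (ε⁻¹ : SpecialLinearGroup (Fin 3) R[X]).1 * ε.1 = 1 :=
    congrArg Subtype.val (inv_mul_cancel ε)
  change (ε⁻¹).1 * δ.1 = _
  rw [h3, ← Matrix.mul_assoc]
  refine (congrArg (fun N => N * _) h4).trans (Matrix.one_mul _)

end Global
end SuslinStability

namespace SuslinStability
open Matrix.SpecialLinearGroup Polynomial

section ChangeOfVariables

open MvPolynomial Nat RingHom List

variable {k : Type*} [Field k] {n : ℕ} (f : MvPolynomial (Fin (n + 1)) k)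
  (v w : Fin (n + 1) →₀ ℕ)

/-- The weight of the `i`-th variable in the change of variables making `f` monic. -/
def weight (i : Fin (n + 1)) : ℕ := (2 + f.totalDegree) ^ i.1

/-- The substitution `X₀ ↦ X₀`, `Xᵢ ↦ Xᵢ + c • X₀ ^ weight i`. -/
noncomputable def shear (c : k) :
    MvPolynomial (Fin (n + 1)) k →ₐ[k] MvPolynomial (Fin (n + 1)) k :=
  aeval fun i => if i = 0 then X 0 else X i + c • X 0 ^ weight f i

theorem shear_comp_shear_neg (c : k) :
    (shear f c).comp (shear f (-c)) = AlgHom.id _ _ := by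
  rw [shear, shear, comp_aeval, ← MvPolynomial.aeval_X_left]
  ext i v
  cases i using Fin.cases <;> simp

/-- The substitution `shear f 1` as an automorphism. -/
noncomputable def shearEquiv : MvPolynomial (Fin (n + 1)) k ≃ₐ[k] MvPolynomial (Fin (n + 1)) k :=
  AlgEquiv.ofAlgHom (shear f 1) (shear f (-1))
    (shear_comp_shear_neg f 1) (by simpa using shear_comp_shear_neg f (-1))

theorem finSuccEquiv_shearEquiv_X (i : Fin (n + 1)) :
    ((finSuccEquiv k n) (shearEquiv f (X i))).Monic ∧
      ((finSuccEquiv k n) (shearEquiv f (X i))).natDegree = weight f i := by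
  change ((finSuccEquiv k n) (shear f 1 (X i))).Monic ∧
      ((finSuccEquiv k n) (shear f 1 (X i))).natDegree = weight f i
  cases i using Fin.cases with
  | zero => simp [shear, weight, finSuccEquiv_X_zero]
  | succ i =>
    have h : (finSuccEquiv k n) (shear f 1 (X i.succ)) =
        Polynomial.X ^ weight f i.succ + Polynomial.C (X i) := by
      simp [shear, finSuccEquiv_X_succ, finSuccEquiv_X_zero, add_comm]
    have hw : weight f i.succ ≠ 0 := pow_ne_zero _ (by omega)
    rw [h]
    exact ⟨monic_X_pow_add_C _ hw, natDegree_X_pow_add_C⟩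

theorem finSuccEquiv_shearEquiv_monomial (a : k) :
    finSuccEquiv k n (shearEquiv f (monomial v a)) =
      Polynomial.C (MvPolynomial.C a) *
        ∏ i, finSuccEquiv k n (shearEquiv f (X i)) ^ v i := by
  rw [monomial_eq, Finsupp.prod_fintype _ _ fun i => pow_zero _]
  simp only [map_mul, map_prod, map_pow]
  congr 1
  rw [← algebraMap_eq, AlgEquiv.commutes, AlgEquiv.commutes]
  rfl

theorem monic_prod_shearEquiv :
    (∏ i, finSuccEquiv k n (shearEquiv f (X i)) ^ v i).Monic :=
  monic_prod_of_monic _ _ fun i _ => (finSuccEquiv_shearEquiv_X f i).1.pow _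

theorem natDegree_shearEquiv_monomial {a : k} (ha : a ≠ 0) :
    (finSuccEquiv k n (shearEquiv f (monomial v a))).natDegree =
      ∑ i, weight f i * v i := by
  rw [finSuccEquiv_shearEquiv_monomial, natDegree_C_mul_of_mul_ne_zero,
    natDegree_prod_of_monic _ _ fun i _ => (finSuccEquiv_shearEquiv_X f i).1.pow _]
  · refine Finset.sum_congr rfl fun i _ => ?_
    rw [(finSuccEquiv_shearEquiv_X f i).1.natDegree_pow, (finSuccEquiv_shearEquiv_X f i).2,
      mul_comm]
  · rw [(monic_prod_shearEquiv f v).leadingCoeff, mul_one]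
    simpa using ha

theorem leadingCoeff_shearEquiv_monomial (a : k) :
    (finSuccEquiv k n (shearEquiv f (monomial v a))).leadingCoeff = MvPolynomial.C a := by
  rw [finSuccEquiv_shearEquiv_monomial, leadingCoeff_mul_monic (monic_prod_shearEquiv f v),
    leadingCoeff_C]

variable {f v w} in
theorem sum_weight_mul_ne (hv : v ∈ f.support) (hw : w ∈ f.support) (ne : v ≠ w) :
    ∑ i, weight f i * v i ≠ ∑ i, weight f i * w i := by
  have hlt : ∀ u ∈ f.support, ∀ l ∈ ofFn u, l < 2 + f.totalDegree := by
    intro u hu l hl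
    obtain ⟨i, rfl⟩ := (List.mem_ofFn' _ _).1 hl
    have := (monomial_le_degreeOf i hu).trans (degreeOf_le_totalDegree f i)
    omega
  intro h
  refine ne <| Finsupp.ext <| congrFun <| ofFn_inj.mp ?_
  apply ofDigits_inj_of_len_eq (Nat.lt_add_right f.totalDegree one_lt_two)
    (by simp) (hlt v hv) (hlt w hw)
  simpa only [weight, ofDigits_eq_sum_mapIdx, mapIdx_eq_ofFn, get_ofFn, length_ofFn,
    Fin.val_cast, mul_comm, sum_ofFn] using! h

variable {f} in
/-- A nonzero polynomial over a field acquires an invertible leading coefficient in the first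
variable after a change of variables. -/
theorem isUnit_leadingCoeff_shearEquiv (hf : f ≠ 0) :
    IsUnit (finSuccEquiv k n (shearEquiv f f)).leadingCoeff := by
  set d : (Fin (n + 1) →₀ ℕ) → ℕ := fun v => ∑ i, weight f i * v i with hd
  obtain ⟨v, hv, hmax⟩ := Finset.exists_max_image f.support d (support_nonempty.mpr hf)
  set h : (Fin (n + 1) →₀ ℕ) → (MvPolynomial (Fin n) k)[X] :=
    fun w => finSuccEquiv k n (shearEquiv f (monomial w (coeff w f))) with hh
  have hne : ∀ w ∈ f.support, h w ≠ 0 := by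
    intro w hw
    simpa [hh] using mem_support_iff.mp hw
  have hdeg : ∀ w ∈ f.support, (h w).degree = d w := by
    intro w hw
    rw [degree_eq_natDegree (hne w hw), hh, natDegree_shearEquiv_monomial f w
      (mem_support_iff.mp hw)]
  have hsum : finSuccEquiv k n (shearEquiv f f) = ∑ w ∈ f.support \ {v}, h w + h v := by
    rw [← Finset.sum_eq_sum_sdiff_singleton_add hv h, ← map_sum, ← map_sum,
      f.support_sum_monomial_coeff]
  have hlt : (∑ w ∈ f.support \ {v}, h w).degree < (h v).degree := by
    refine (degree_sum_le _ _).trans_lt ((Finset.sup_lt_iff ?_).2 fun w hw => ?_)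
    · exact Ne.bot_lt fun e => hne v hv (degree_eq_bot.mp e)
    · obtain ⟨hw, hwv⟩ := Finset.mem_sdiff.1 hw
      rw [hdeg w hw, hdeg v hv]
      exact_mod_cast lt_of_le_of_ne (hmax w hw)
        (sum_weight_mul_ne hw hv fun e => hwv (Finset.mem_singleton.2 e))
  rw [hsum, leadingCoeff_add_of_degree_lt hlt, hh, leadingCoeff_shearEquiv_monomial]
  exact (mem_support_iff.mp hv).isUnit.map MvPolynomial.C

end ChangeOfVariables

variable {k : Type*} [Field k]

theorem exists_ringEquiv_isUnit_leadingCoeff {n : ℕ} {f : MvPolynomial (Fin (n + 1)) k}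
    (hf : f ≠ 0) :
    ∃ e : MvPolynomial (Fin (n + 1)) k ≃+* (MvPolynomial (Fin n) k)[X],
      IsUnit (e f).leadingCoeff :=
  ⟨((shearEquiv f).trans (MvPolynomial.finSuccEquiv k n)).toRingEquiv,
    isUnit_leadingCoeff_shearEquiv hf⟩

section Monic

variable {R : Type*} [CommRing R]

/-- Adding a suitable multiple of a polynomial with invertible leading coefficient makes any
polynomial monic. -/
theorem exists_monic_add_mul {f : R[X]} (hf : IsUnit f.leadingCoeff) (g : R[X]) :
    ∃ t : R[X], (g + t * f).Monic := by
  obtain ⟨u, hu⟩ := hf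
  nontriviality R
  have h1 : (C (↑u⁻¹ : R) * f).Monic := by
    rw [Monic, leadingCoeff_C_mul_of_isUnit (u⁻¹).isUnit, ← hu, Units.inv_mul]
  refine ⟨X ^ (g.natDegree + 1) * C (↑u⁻¹ : R), ?_⟩
  rw [mul_assoc]
  have h2 := (monic_X_pow (R := R) (g.natDegree + 1)).mul h1
  refine h2.add_of_right ?_
  rw [degree_eq_natDegree h2.ne_zero, (monic_X_pow _).natDegree_mul h1, natDegree_X_pow]
  refine degree_le_natDegree.trans_lt ?_
  exact_mod_cast (by omega)

end Monic

section Columns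

variable {ι : Type*} [DecidableEq ι] [Fintype ι]

theorem elemRel_single_of_mvPolynomial (hι : 3 ≤ Fintype.card ι) (i₀ : ι) (n : ℕ)
    (f : ι → MvPolynomial (Fin n) k) (hf : Unimodular f) : ElemRel f (Pi.single i₀ 1) := by
  have : Nontrivial ι := Fintype.one_lt_card_iff_nontrivial.1 (by omega)
  have hne : ∀ {n} (f : ι → MvPolynomial (Fin n) k), Unimodular f → ∃ i, f i ≠ 0 := by
    rintro n f ⟨g, hg⟩
    by_contra! h
    have : f = 0 := funext h
    simp [this] at hg
  induction n with
  | zero =>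
    obtain ⟨i, hi⟩ := hne f hf
    refine elemRel_single_of_isUnit (j := i) ?_ i₀
    rw [← MulEquiv.isUnit_map (MvPolynomial.isEmptyRingEquiv k (Fin 0))]
    exact IsUnit.mk0 _ ((map_ne_zero_iff _ (RingEquiv.injective _)).2 hi)
  | succ n ih =>
    obtain ⟨i, hi⟩ := hne f hf
    obtain ⟨e, he⟩ := exists_ringEquiv_isUnit_leadingCoeff hi
    obtain ⟨j, hj⟩ := exists_ne i
    obtain ⟨t, ht⟩ := exists_monic_add_mul he (e (f j))
    have hfe : Unimodular (e ∘ f) := hf.map e.toRingHom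
    have h1 := elemRel_update (e ∘ f) hj t
    have h2 := h1.trans (elemRel_single_of_monic hι i₀ ih _ j (by simpa using ht)
      (hfe.of_elemRel h1))
    have h3 := h2.map e.symm.toRingHom
    convert h3 using 1
    · ext1 l; simp
    · ext1 l
      rcases eq_or_ne l i₀ with rfl | h <;> simp [*]

end Columns

theorem stablyElem_of_mvPolynomial (n : ℕ) (a b c d : MvPolynomial (Fin n) k)
    (hdet : a * d - b * c = 1) : StablyElem a b c d := by
  induction n with
  | zero =>
    have hu : ∀ x : MvPolynomial (Fin 0) k, x ≠ 0 → IsUnit x := by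
      intro x hx
      rw [← MulEquiv.isUnit_map (MvPolynomial.isEmptyRingEquiv k (Fin 0))]
      exact IsUnit.mk0 _ ((map_ne_zero_iff _ (RingEquiv.injective _)).2 hx)
    by_cases ha : a = 0
    · refine StablyElem.of_isUnit_right hdet (hu b ?_)
      rintro rfl
      simp [ha] at hdet
    · exact StablyElem.of_isUnit_left hdet (hu a ha)
  | succ n ih =>
    by_cases ha : a = 0
    · refine StablyElem.of_isUnit_right hdet (IsUnit.of_mul_eq_one (-c) ?_)
      rw [ha] at hdet
      linear_combination hdet
    obtain ⟨e, he⟩ := exists_ringEquiv_isUnit_leadingCoeff ha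
    have hdet' : e a * e d - e b * e c = 1 := by
      rw [← map_mul, ← map_mul, ← map_sub, hdet, map_one]
    obtain ⟨t, ht⟩ := exists_monic_add_mul he (e b)
    obtain ⟨s, hs⟩ := exists_monic_add_mul (f := e b + t * e a) (by simp [ht.leadingCoeff]) (e a)
    have h : StablyElem (e a) (e b) (e c) (e d) :=
      StablyElem.of_col₂ t (StablyElem.of_col₁ s (stablyElem_of_monic ih _ _ _ _ hs
        (by linear_combination hdet')))
    simpa using h.map e.symm.toRingHom

end SuslinStability

namespace SuslinStability
open Matrix.SpecialLinearGroup Polynomial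

section Blocks

variable {ι κ : Type*} [DecidableEq ι] [Fintype ι] [DecidableEq κ] [Fintype κ]
  {R : Type*} [CommRing R]

theorem IsElem.of_monoidHom (f : Matrix ι ι R →* Matrix κ κ R)
    (hf : ∀ (i j : ι) (c : R), i ≠ j → IsElem (f (Matrix.transvection i j c)))
    {M : Matrix ι ι R} (hM : IsElem M) : IsElem (f M) := by
  obtain ⟨g, hg, rfl⟩ := hM
  refine elem_induction_left (p := fun g => IsElem (f g.1)) ?_ ?_ hg
  · change IsElem (f 1)
    rw [map_one]
    exact IsElem.one
  · intro i j h c g ih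
    change IsElem (f (Matrix.transvection i j c * g.1))
    rw [map_mul]
    exact (hf i j c h).mul ih

theorem IsElem.reindex (e : ι ≃ κ) {M : Matrix ι ι R} (hM : IsElem M) :
    IsElem (Matrix.reindex e e M) := by
  refine IsElem.of_monoidHom ((reindexAlgEquiv R R e : _ →* Matrix κ κ R)) ?_ hM
  intro i j c h
  have := (TransvectionStruct.mk i j h c).toMatrix_reindexEquiv e
  change IsElem (reindexAlgEquiv R R e (TransvectionStruct.mk i j h c).toMatrix)
  rw [← this]
  exact IsElem.transvection (TransvectionStruct.hij _) _

theorem IsElem.fromBlocks_one {M : Matrix ι ι R} (hM : IsElem M) :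
    IsElem (fromBlocks M 0 0 (1 : Matrix κ κ R)) := by
  refine IsElem.of_monoidHom
    { toFun := fun M : Matrix ι ι R => fromBlocks M 0 0 (1 : Matrix κ κ R)
      map_one' := Matrix.fromBlocks_one
      map_mul' := fun M N => by simp [fromBlocks_multiply] } ?_ hM
  intro i j c h
  have := (TransvectionStruct.mk i j h c).toMatrix_sumInl κ
  change IsElem (fromBlocks (TransvectionStruct.mk i j h c).toMatrix 0 0 1)
  rw [← this]
  exact IsElem.transvection (TransvectionStruct.hij _) _

theorem isElem_fromBlocks_lower (c : Matrix κ ι R) :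
    IsElem (fromBlocks (1 : Matrix ι ι R) 0 c (1 : Matrix κ κ R)) := by
  induction c using Matrix.induction_on' with
  | h_zero => rw [Matrix.fromBlocks_one]; exact IsElem.one
  | h_add c d hc hd =>
    have := hc.mul hd
    simpa [fromBlocks_multiply] using this
  | h_std_basis i j x =>
    have := IsElem.transvection (R := R) (i := (Sum.inr i : ι ⊕ κ)) (j := Sum.inl j)
      (by simp) x
    convert this using 1
    ext a b
    rcases a with a | a <;> rcases b with b | b <;>
      simp [Matrix.transvection, Matrix.single, one_apply]

theorem isElem_of_fromBlocks
    (hblock : ∀ A : Matrix ι ι R, A.det = 1 →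
      IsElem (fromBlocks A 0 0 (1 : Matrix (Fin 1) (Fin 1) R)))
    (hcol : ∀ f : ι ⊕ Fin 1 → R, Unimodular f → ElemRel f (Pi.single (Sum.inr 0) 1))
    (M : Matrix (ι ⊕ Fin 1) (ι ⊕ Fin 1) R) (hM : M.det = 1) : IsElem M := by
  obtain ⟨ε, hε, h⟩ := hcol (fun i => M i (Sum.inr 0)) ⟨M.adjugate (Sum.inr 0), by
    have := congrFun (congrFun (adjugate_mul M) (Sum.inr 0)) (Sum.inr 0)
    simpa [hM, Matrix.mul_apply, dotProduct] using this⟩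
  obtain ⟨N, hN⟩ : ∃ N, N = ε.1 * M := ⟨_, rfl⟩
  have hNdet : N.det = 1 := by rw [hN, det_mul, hM, mul_one]; exact ε.2
  have hNcol : ∀ i, N i (Sum.inr 0) = (Pi.single (Sum.inr 0) 1 : ι ⊕ Fin 1 → R) i := by
    intro i
    rw [← h, hN]
    rfl
  have h12 : N.toBlocks₁₂ = 0 := by
    ext i j
    rw [Subsingleton.elim j 0]
    simp [toBlocks₁₂, hNcol]
  have h22 : N.toBlocks₂₂ = 1 := by
    ext i j
    rw [Subsingleton.elim j 0, Subsingleton.elim i 0]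
    simp [toBlocks₂₂, hNcol]
  have hNb : N = fromBlocks N.toBlocks₁₁ 0 N.toBlocks₂₁ 1 := by
    rw [← h12, ← h22, fromBlocks_toBlocks]
  have hA : N.toBlocks₁₁.det = 1 := by
    rw [hNb, det_fromBlocks_zero₁₂, det_one, mul_one] at hNdet
    exact hNdet
  have hNelem : IsElem N := by
    rw [hNb]
    convert (hblock _ hA).mul (isElem_fromBlocks_lower N.toBlocks₂₁) using 1
    simp [fromBlocks_multiply]
  have hinv : IsElem (ε⁻¹).1 := ⟨_, inv_mem hε, rfl⟩
  convert hinv.mul hNelem using 1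
  have h4 : (ε⁻¹).1 * ε.1 = 1 := congrArg Subtype.val (inv_mul_cancel ε)
  rw [hN, ← Matrix.mul_assoc]
  exact ((congrArg (fun N => N * M) h4).trans (Matrix.one_mul _)).symm

end Blocks

section Suslin

variable {k : Type*} [Field k]

/-- Suslin's stability theorem: over a polynomial ring over a field, every matrix of determinant
one and size at least three is a product of elementary matrices. -/
theorem isElem_of_det_eq_one (n m : ℕ)
    (M : Matrix (Fin (m + 3)) (Fin (m + 3)) (MvPolynomial (Fin n) k))
    (hM : M.det = 1) : IsElem M := by
  have key : ∀ l, 2 ≤ l →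
      (∀ A : Matrix (Fin l) (Fin l) (MvPolynomial (Fin n) k), A.det = 1 →
        IsElem (fromBlocks A 0 0 (1 : Matrix (Fin 1) (Fin 1) (MvPolynomial (Fin n) k)))) →
      ∀ M : Matrix (Fin (l + 1)) (Fin (l + 1)) (MvPolynomial (Fin n) k), M.det = 1 →
        IsElem M := by
    intro l hl hblock M hM
    have := isElem_of_fromBlocks hblock
      (elemRel_single_of_mvPolynomial (by simp; omega) _ n)
      (Matrix.reindex finSumFinEquiv.symm finSumFinEquiv.symm M)
      (by rw [det_reindex_self, hM])
    simpa using this.reindex finSumFinEquiv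
  induction m with
  | zero =>
    refine key 2 le_rfl (fun A hA => ?_) M hM
    rw [det_fin_two] at hA
    have := stablyElem_of_mvPolynomial n _ _ _ _ hA
    have := IsElem.reindex (finSumFinEquiv (m := 2) (n := 1)).symm this
    convert this using 1
    ext1 i j
    rcases i with i | i <;> rcases j with j | j <;> fin_cases i <;> fin_cases j <;> rfl
  | succ m ih =>
    exact key (m + 3) (by omega) (fun A hA => (ih A hA).fromBlocks_one) M hM

end Suslin
end SuslinStability

namespace SuslinStability
open Matrix.SpecialLinearGroup MvPolynomial

section Scaling

variable {σ ι A B : Type*} [CommRing A] [CommRing B]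

/-- The substitution multiplying every variable by the constant `c`. -/
noncomputable def scaleVars (c : A) : MvPolynomial σ A →+* MvPolynomial σ A :=
  eval₂Hom C fun i => C c * X i

theorem scaleVars_monomial (c : A) (d : σ →₀ ℕ) (a : A) :
    scaleVars c (monomial d a) = monomial d (c ^ d.degree * a) := by
  rw [scaleVars, coe_eval₂Hom, eval₂_monomial, monomial_eq, C_mul, C_pow,
    show d.degree = ∑ i ∈ d.support, d i from rfl, ← Finset.prod_pow_eq_pow_sum]
  simp only [Finsupp.prod, mul_pow, Finset.prod_mul_distrib]
  ring

theorem coeff_scaleVars (c : A) (f : MvPolynomial σ A) (d : σ →₀ ℕ) :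
    (scaleVars c f).coeff d = c ^ d.degree * f.coeff d := by
  classical
  induction f using MvPolynomial.induction_on' with
  | monomial e a =>
    rw [scaleVars_monomial, coeff_monomial, coeff_monomial]
    split_ifs with h
    · rw [h]
    · rw [mul_zero]
  | add f g hf hg => rw [map_add, coeff_add, coeff_add, hf, hg, mul_add]

theorem scaleVars_scaleVars {c c' : A} (h : c * c' = 1) (f : MvPolynomial σ A) :
    scaleVars c (scaleVars c' f) = f := by
  ext d
  rw [coeff_scaleVars, coeff_scaleVars, ← mul_assoc, ← mul_pow, h, one_pow, one_mul]

variable {φ : B →+* A} {t : B}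

theorem exists_forall_pow_mul_mem_range (hφ : ∀ a : A, ∃ N, φ t ^ N * a ∈ φ.range)
    (s : Finset A) : ∃ N₀, ∀ N ≥ N₀, ∀ a ∈ s, φ t ^ N * a ∈ φ.range := by
  choose N hN using hφ
  refine ⟨s.sup N, fun M hM a ha => ?_⟩
  have h : N a ≤ M := (Finset.le_sup ha).trans hM
  rw [← Nat.sub_add_cancel h, pow_add, mul_assoc]
  exact mul_mem (pow_mem (φ.mem_range_self t) _) (hN a)

variable [Fintype ι] [DecidableEq ι]

theorem exists_map_eq_scaleVars (hφ : ∀ a : A, ∃ N, φ t ^ N * a ∈ φ.range)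
    (M : Matrix ι ι (MvPolynomial σ A)) (hM : M.map constantCoeff = 1) :
    ∃ N, ∃ H : Matrix ι ι (MvPolynomial σ B),
      H.map (MvPolynomial.map φ) = M.map (scaleVars (φ t ^ N)) := by
  classical
  obtain ⟨N, hN⟩ := exists_forall_pow_mul_mem_range hφ
    (Finset.univ.biUnion fun ij : ι × ι => (M ij.1 ij.2).coeffs)
  have key : ∀ i j, scaleVars (φ t ^ N) (M i j) ∈ Set.range (MvPolynomial.map (σ := σ) φ) := by
    intro i j
    rw [mem_range_map_iff_coeffs_subset]
    intro x hx
    obtain ⟨d, -, rfl⟩ := mem_coeffs_iff.1 hx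
    change _ ∈ φ.range
    rw [coeff_scaleVars]
    by_cases h0 : (M i j).coeff d = 0
    · rw [h0, mul_zero]
      exact zero_mem _
    by_cases hd : d = 0
    · have := congrFun (congrFun hM i) j
      rw [map_apply, constantCoeff_eq] at this
      rw [hd, this, map_zero, pow_zero, one_mul, one_apply]
      split_ifs
      exacts [one_mem _, zero_mem _]
    · rw [← pow_mul]
      refine hN _ ?_ _ (Finset.mem_biUnion.2 ⟨(i, j), Finset.mem_univ _, coeff_mem_coeffs _ h0⟩)
      exact Nat.le_mul_of_pos_right _
        (Nat.pos_of_ne_zero fun h => hd ((Finsupp.degree_eq_zero_iff d).1 h))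
  choose H hH using key
  exact ⟨N, Matrix.of H, by ext1 i j; exact hH i j⟩

theorem isElem_of_constantCoeff_eq_one (hinj : Function.Injective φ) (ht : IsUnit (φ t))
    (hφ : ∀ a : A, ∃ N, φ t ^ N * a ∈ φ.range)
    (hB : ∀ H : Matrix ι ι (MvPolynomial σ B), H.det = 1 → IsElem H)
    (M : Matrix ι ι (MvPolynomial σ A)) (hdet : M.det = 1) (hM : M.map constantCoeff = 1) :
    IsElem M := by
  obtain ⟨N, H, hH⟩ := exists_map_eq_scaleVars hφ M hM
  have hHdet : H.det = 1 := by
    refine map_injective φ hinj ?_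
    rw [RingHom.map_det, map_one, RingHom.mapMatrix_apply, hH, ← RingHom.mapMatrix_apply,
      ← RingHom.map_det, hdet, map_one]
  have h := (hB H hHdet).map (MvPolynomial.map φ)
  rw [hH] at h
  obtain ⟨u, hu⟩ := ht.pow N
  have h' := h.map (scaleVars (↑u⁻¹ : A))
  convert h' using 1
  ext1 i j
  simp only [map_apply]
  rw [scaleVars_scaleVars (by rw [← hu, Units.inv_mul])]

end Scaling

section Laurent

variable (k : Type*) [Field k] (n : ℕ)

/-- The inclusion of the polynomial ring into the Laurent polynomial ring. -/
noncomputable def toLaurent : MvPolynomial (Fin n) k →+* AddMonoidAlgebra k (Fin n →₀ ℤ) :=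
  AddMonoidAlgebra.mapDomainRingHom k
    (Finsupp.mapRange.addMonoidHom (ι := Fin n) (Nat.castAddMonoidHom ℤ))

/-- The product of the variables. -/
noncomputable def prodVars : MvPolynomial (Fin n) k :=
  monomial (Finsupp.equivFunOnFinite.symm 1) 1

theorem toLaurent_injective : Function.Injective (toLaurent k n) :=
  AddMonoidAlgebra.mapDomain_injective
    (Finsupp.mapRange_injective _ (map_zero _) Nat.cast_injective)

theorem toLaurent_monomial (d : Fin n →₀ ℕ) (a : k) :
    toLaurent k n (monomial d a) =
      AddMonoidAlgebra.single (d.mapRange (Nat.cast : ℕ → ℤ) Nat.cast_zero) a :=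
  AddMonoidAlgebra.mapDomain_single

theorem toLaurent_prodVars_pow (N : ℕ) :
    toLaurent k n (prodVars k n) ^ N =
      AddMonoidAlgebra.single (Finsupp.equivFunOnFinite.symm fun _ => (N : ℤ)) 1 := by
  rw [prodVars, toLaurent_monomial, AddMonoidAlgebra.single_pow, one_pow]
  congr 1
  ext i
  simp

theorem isUnit_toLaurent_prodVars : IsUnit (toLaurent k n (prodVars k n)) := by
  refine IsUnit.of_mul_eq_one
    (AddMonoidAlgebra.single (Finsupp.equivFunOnFinite.symm fun _ => (-1 : ℤ)) 1) ?_
  have h := toLaurent_prodVars_pow k n 1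
  rw [pow_one] at h
  rw [h, AddMonoidAlgebra.single_mul_single, AddMonoidAlgebra.one_def, one_mul]
  congr 1
  ext i
  simp

theorem exists_pow_mul_mem_range_toLaurent (a : AddMonoidAlgebra k (Fin n →₀ ℤ)) :
    ∃ N, toLaurent k n (prodVars k n) ^ N * a ∈ (toLaurent k n).range := by
  induction a using AddMonoidAlgebra.induction_linear with
  | zero => exact ⟨0, by rw [mul_zero]; exact zero_mem _⟩
  | add x y hx hy =>
    obtain ⟨N, hN⟩ := hx
    obtain ⟨N', hN'⟩ := hy
    refine ⟨N + N', ?_⟩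
    have e : ∀ T : AddMonoidAlgebra k (Fin n →₀ ℤ),
        T ^ (N + N') * (x + y) = T ^ N' * (T ^ N * x) + T ^ N * (T ^ N' * y) := by
      intro T
      ring
    rw [e]
    exact add_mem (mul_mem (pow_mem (RingHom.mem_range_self _ _) _) hN)
      (mul_mem (pow_mem (RingHom.mem_range_self _ _) _) hN')
  | single d a =>
    obtain ⟨N, hN⟩ : ∃ N : ℕ, ∀ i, -d i ≤ N :=
      ⟨Finset.univ.sup fun i => (-d i).toNat, fun i => (Int.self_le_toNat _).trans
        (by exact_mod_cast Finset.le_sup (f := fun i => (-d i).toNat) (Finset.mem_univ i))⟩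
    refine ⟨N, monomial (Finsupp.equivFunOnFinite.symm fun i => (N + d i).toNat) a, ?_⟩
    rw [toLaurent_monomial, toLaurent_prodVars_pow, AddMonoidAlgebra.single_mul_single, one_mul]
    congr 1
    ext i
    have := hN i
    simp
    omega

end Laurent

theorem isElem_of_iterated_mvPolynomial {k : Type*} [Field k] (n p m : ℕ)
    (H : Matrix (Fin (m + 3)) (Fin (m + 3)) (MvPolynomial (Fin p) (MvPolynomial (Fin n) k)))
    (hH : H.det = 1) : IsElem H := by
  obtain ⟨e⟩ : Nonempty (MvPolynomial (Fin p) (MvPolynomial (Fin n) k) ≃+*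
      MvPolynomial (Fin (p + n)) k) :=
    ⟨(sumRingEquiv k (Fin p) (Fin n)).symm.trans (renameEquiv k finSumFinEquiv).toRingEquiv⟩
  have h := isElem_of_det_eq_one (k := k) (p + n) m (H.map e.toRingHom) (by
    rw [← RingHom.mapMatrix_apply, ← RingHom.map_det, hH, map_one])
  convert h.map e.symm.toRingHom using 1
  ext1 i j
  simp

end SuslinStability

/-- Lemma 4.4 (ii) of the paper, for `SL_m` (`m ≥ 3`), over a field `k` of characteristic 0:
for `g ∈ SL_m(k[x₁^{±1},…,xₙ^{±1}][y₁,…,y_p])`, if `g₀` denotes the result of the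
substitution `y₁ = … = y_p = 0` (the constant coefficient), then
`g·g₀⁻¹ ∈ E_m(k[x₁^{±1},…,xₙ^{±1}][y₁,…,y_p])`; equivalently,
`K1^{SL_m}(k[x₁^{±1},…,xₙ^{±1}]) ≅ K1^{SL_m}(k[x₁^{±1},…,xₙ^{±1}][y₁,…,y_p])`. -/
theorem k1_laurentPoly_poly_vars_invariance
    (k : Type*) [Field k] [CharZero k]
    (m : ℕ) (hm : 3 ≤ m) (n p : ℕ)
    (g : SpecialLinearGroup (Fin m) (MvPolynomial (Fin p) (AddMonoidAlgebra k (Fin n →₀ ℤ)))) :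
    g * (SpecialLinearGroup.map ((MvPolynomial.C :
            AddMonoidAlgebra k (Fin n →₀ ℤ) →+*
              MvPolynomial (Fin p) (AddMonoidAlgebra k (Fin n →₀ ℤ))).comp
          (MvPolynomial.constantCoeff))
        g)⁻¹
      ∈ ElemSubgroup m (MvPolynomial (Fin p) (AddMonoidAlgebra k (Fin n →₀ ℤ))) := by
  obtain ⟨m, rfl⟩ := Nat.exists_eq_add_of_le' hm
  set h := g * (SpecialLinearGroup.map ((MvPolynomial.C :
            AddMonoidAlgebra k (Fin n →₀ ℤ) →+*
              MvPolynomial (Fin p) (AddMonoidAlgebra k (Fin n →₀ ℤ))).comp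
          (MvPolynomial.constantCoeff)) g)⁻¹ with hh
  have h1 : SpecialLinearGroup.map (MvPolynomial.constantCoeff (σ := Fin p)
      (R := AddMonoidAlgebra k (Fin n →₀ ℤ))) h = 1 := by
    rw [hh, map_mul, map_inv, mul_inv_eq_one]
    ext i j
    simp
  obtain ⟨ε, hε, e⟩ := SuslinStability.isElem_of_constantCoeff_eq_one
    (SuslinStability.toLaurent_injective k n) (SuslinStability.isUnit_toLaurent_prodVars k n)
    (SuslinStability.exists_pow_mul_mem_range_toLaurent k n)
    (SuslinStability.isElem_of_iterated_mvPolynomial n p m) h.1 h.2 (congrArg Subtype.val h1)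
  rw [← Subtype.ext e]
  exact hε
end

section
/- Let k be a field and m ≥ 3 an integer. For any n, p ≥ 0, the group SL_m(k[y₁,…,y_p, x₁^{±1},…,xₙ^{±1}]) coincides with its elementary subgroup E_m(k[y₁,…,y_p, x₁^{±1},…,xₙ^{±1}]): every m×m matrix of determinant 1 over the mixed polynomial/Laurent polynomial ring k[y₁,…,y_p, x₁^{±1},…,xₙ^{±1}] is a product of elementary matrices. Equivalently, K1^{SL_m}(k[y₁,…,y_p, x₁^{±1},…,xₙ^{±1}]) ≅ K1^{SL_m}(k) is trivial. -/
open Matrix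

namespace ElemSubgroup

open SpecialLinearGroup

section Basic

variable {m : ℕ} {S S' : Type*} [CommRing S] [CommRing S']

theorem transvection_mem {i j : Fin m} (h : i ≠ j) (a : S) :
    transvection h a ∈ ElemSubgroup m S :=
  Subgroup.subset_closure ⟨i, j, a, h, rfl⟩

theorem le_of_transvection_mem {H : Subgroup (SpecialLinearGroup (Fin m) S)}
    (hH : ∀ (i j : Fin m) (h : i ≠ j) (a : S), transvection h a ∈ H) :
    ElemSubgroup m S ≤ H := by
  refine (Subgroup.closure_le H).2 ?_
  rintro g ⟨i, j, a, h, hg⟩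
  have : g = transvection h a := Subtype.ext hg
  exact this ▸ hH i j h a

theorem map_transvection (f : S →+* S') {i j : Fin m} (h : i ≠ j) (a : S) :
    SpecialLinearGroup.map f (transvection h a) = transvection h (f a) := by
  ext k l
  simp [transvection_coe, Matrix.one_apply, Matrix.single_apply, apply_ite f]

theorem map_mem (f : S →+* S') {g : SpecialLinearGroup (Fin m) S} (hg : g ∈ ElemSubgroup m S) :
    SpecialLinearGroup.map f g ∈ ElemSubgroup m S' := by
  have : ElemSubgroup m S ≤ (ElemSubgroup m S').comap (SpecialLinearGroup.map f) :=
    le_of_transvection_mem fun i j h a ↦ by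
      simpa [map_transvection] using transvection_mem h (f a)
  exact this hg

theorem forall_mem_of_ringEquiv (e : S ≃+* S') (hS : ∀ g, g ∈ ElemSubgroup m S)
    (g : SpecialLinearGroup (Fin m) S') : g ∈ ElemSubgroup m S' := by
  have h := map_mem (e : S →+* S') (hS (SpecialLinearGroup.map (e.symm : S' →+* S) g))
  have hg : SpecialLinearGroup.map (e : S →+* S')
      (SpecialLinearGroup.map (e.symm : S' →+* S) g) = g := by
    ext i j; simp
  rwa [hg] at h

theorem conj_transvection_of_eq {i j k : Fin m} (hij : i ≠ j) (hjk : j ≠ k) (hik : i ≠ k)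
    (a x : S) :
    transvection hjk x * transvection hij a * (transvection hjk x)⁻¹ =
      transvection hij a * transvection hik (-(a * x)) := by
  rw [mul_inv_eq_iff_eq_mul]
  ext1
  simp [transvection_coe, Matrix.mul_add, Matrix.add_mul, hik.symm, hij.symm, hjk.symm,
    Matrix.single_mul_single_of_ne]
  rw [← Matrix.single_neg, Matrix.neg_apply]
  abel

theorem conj_transvection_of_eq' {i j k : Fin m} (hij : i ≠ j) (hki : k ≠ i) (hkj : k ≠ j)
    (a x : S) :
    transvection hki x * transvection hij a * (transvection hki x)⁻¹ =
      transvection hkj (x * a) * transvection hij a := by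
  rw [mul_inv_eq_iff_eq_mul]
  ext1
  simp [transvection_coe, Matrix.mul_add, Matrix.add_mul, hij.symm, hkj.symm,
    Matrix.single_mul_single_of_ne]
  abel

theorem conj_transvection_of_ne {i j k l : Fin m} (hij : i ≠ j) (hkl : k ≠ l) (hjk : j ≠ k)
    (hil : i ≠ l) (a x : S) :
    transvection hkl x * transvection hij a * (transvection hkl x)⁻¹ = transvection hij a := by
  rw [mul_inv_eq_iff_eq_mul]
  ext1
  simp [transvection_coe, Matrix.mul_add, Matrix.add_mul, hil.symm, hjk,
    Matrix.single_mul_single_of_ne]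
  abel

theorem transvection_mul_eq_commutator {i j k : Fin m} (hij : i ≠ j) (hjk : j ≠ k) (hik : i ≠ k)
    (a b : S) :
    transvection hik (a * b) =
      transvection hij a * transvection hjk b * (transvection hij a)⁻¹ *
        (transvection hjk b)⁻¹ := by
  rw [conj_transvection_of_eq' hjk hij hik, mul_assoc, mul_inv_cancel, mul_one]

end Basic

section Dilation

variable {m : ℕ} {T L : Type*} [CommRing T] [CommRing L]

/-- The subgroup generated by the transvections whose parameters are images of multiples of `s`. -/
def cong (m : ℕ) (φ : T →+* L) (s : T) : Subgroup (SpecialLinearGroup (Fin m) L) :=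
  Subgroup.closure { g | ∃ (i j : Fin m) (h : i ≠ j) (c : T), g = transvection h (φ (s * c)) }

theorem transvection_mem_cong (φ : T →+* L) {i j : Fin m} (h : i ≠ j) {s c : T} {x : L}
    (hx : x = φ (s * c)) : transvection h x ∈ cong m φ s :=
  Subgroup.subset_closure ⟨i, j, h, c, by rw [hx]⟩

theorem cong_anti (φ : T →+* L) {s s' : T} (h : s ∣ s') : cong m φ s' ≤ cong m φ s := by
  obtain ⟨d, rfl⟩ := h
  refine (Subgroup.closure_le _).2 ?_
  rintro g ⟨i, j, h, c, rfl⟩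
  exact transvection_mem_cong φ h (c := d * c) (by rw [mul_assoc])

theorem exists_map_eq_of_mem_cong (φ : T →+* L) {s : T} {g : SpecialLinearGroup (Fin m) L}
    (hg : g ∈ cong m φ s) : ∃ ε ∈ ElemSubgroup m T, SpecialLinearGroup.map φ ε = g := by
  have : cong m φ s ≤ (ElemSubgroup m T).map (SpecialLinearGroup.map φ) := by
    refine (Subgroup.closure_le _).2 ?_
    rintro g ⟨i, j, h, c, rfl⟩
    exact ⟨_, transvection_mem h (s * c), map_transvection φ h _⟩
  exact this hg

theorem conj_mem_cong_of_not_opposite (φ : T →+* L) {s t c₀ b : T} {x u : L}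
    (hx : φ t * x = φ c₀) (hu : u = φ (s * t * b)) {i j k l : Fin m} (hij : i ≠ j) (hkl : k ≠ l)
    (hopp : ¬ (i = l ∧ j = k)) :
    transvection hkl x * transvection hij u * (transvection hkl x)⁻¹ ∈ cong m φ s := by
  have hmem : transvection hij u ∈ cong m φ s :=
    transvection_mem_cong φ hij (c := t * b) (by rw [hu, mul_assoc])
  have hxu : x * u = φ (s * (c₀ * b)) := by
    rw [hu]; simp only [map_mul, ← hx]; ring
  by_cases hjk : j = k
  · subst hjk
    have hil : i ≠ l := fun h ↦ hopp ⟨h, rfl⟩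
    rw [conj_transvection_of_eq hij hkl hil]
    refine mul_mem hmem (transvection_mem_cong φ hil (c := -(c₀ * b)) ?_)
    rw [mul_comm u, hxu, mul_neg, map_neg]
  · by_cases hil : i = l
    · subst hil
      rw [conj_transvection_of_eq' hij hkl (Ne.symm hjk)]
      exact mul_mem (transvection_mem_cong φ _ hxu) hmem
    · rwa [conj_transvection_of_ne hij hkl hjk hil]

theorem exists_ne_ne (hm : 3 ≤ m) (i j : Fin m) : ∃ p : Fin m, i ≠ p ∧ p ≠ j := by
  have : ({i, j} : Finset (Fin m)).card < Fintype.card (Fin m) := by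
    rw [Fintype.card_fin]
    exact (Finset.card_le_two).trans_lt (by omega)
  obtain ⟨p, hp⟩ := Finset.exists_mem_notMem_of_card_lt_card
    (s := {i, j}) (t := Finset.univ) (by simpa using this)
  simp only [Finset.mem_insert, Finset.mem_singleton, not_or] at hp
  exact ⟨p, Ne.symm hp.2.1, hp.2.2⟩

theorem conj_mem_cong (hm : 3 ≤ m) (φ : T →+* L) (s : T) {t c₀ : T} {x : L}
    (hx : φ t * x = φ c₀) {k l : Fin m} (hkl : k ≠ l) {g : SpecialLinearGroup (Fin m) L}
    (hg : g ∈ cong m φ ((s * t) ^ 2)) :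
    transvection hkl x * g * (transvection hkl x)⁻¹ ∈ cong m φ s := by
  have : cong m φ ((s * t) ^ 2) ≤
      (cong m φ s).comap (MulAut.conj (transvection hkl x)).toMonoidHom := by
    refine (Subgroup.closure_le _).2 ?_
    rintro g ⟨i, j, hij, b, rfl⟩
    simp only [Subgroup.coe_comap, Set.mem_preimage, MulEquiv.toMonoidHom_eq_coe,
      MonoidHom.coe_coe, SetLike.mem_coe]
    by_cases hopp : i = l ∧ j = k
    · obtain ⟨p, hip, hpj⟩ := exists_ne_ne hm i j
      have hsplit : φ ((s * t) ^ 2 * b) = φ (s * t * b) * φ (s * t * 1) := by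
        rw [← map_mul]; congr 1; ring
      rw [hsplit, transvection_mul_eq_commutator hip hpj hij]
      simp only [map_mul, map_inv]
      have h1 := conj_mem_cong_of_not_opposite (s := s) φ hx (b := b) rfl hip hkl
        (fun h ↦ hpj (h.2.trans hopp.2.symm))
      have h2 := conj_mem_cong_of_not_opposite (s := s) φ hx (b := 1) rfl hpj hkl
        (fun h ↦ hip (hopp.1.trans h.1.symm))
      simp only [MulAut.conj_apply]
      exact mul_mem (mul_mem (mul_mem (by simpa using h1) (by simpa using h2))
        (inv_mem (by simpa using h1))) (inv_mem (by simpa using h2))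
    · simpa using conj_mem_cong_of_not_opposite φ hx (b := s * t * b)
        (congrArg φ (show (s * t) ^ 2 * b = s * t * (s * t * b) by ring)) hij hkl hopp
  simpa using this hg

/-- Functions `F : T → SL_m(L)` that vary by elements liftable to `E_m(T)` under small
perturbations of the argument, and along which conjugation is uniformly continuous for the
topology defined by the subgroups `cong m φ s`, `s ∈ M`. -/
def uniform (m : ℕ) (φ : T →+* L) (M : Submonoid T) :
    Subgroup (T → SpecialLinearGroup (Fin m) L) where
  carrier := { F | (∀ s' ∈ M, ∃ s ∈ M, ∀ a b, (F (a + s * b))⁻¹ * F a ∈ cong m φ s') ∧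
    ∀ s' ∈ M, ∃ s ∈ M, ∀ a, ∀ g ∈ cong m φ s,
      F a * g * (F a)⁻¹ ∈ cong m φ s' ∧ (F a)⁻¹ * g * F a ∈ cong m φ s' }
  one_mem' := ⟨fun s' hs' ↦ ⟨s', hs', fun a b ↦ by simp⟩,
    fun s' hs' ↦ ⟨s', hs', fun a g hg ↦ by simpa using hg⟩⟩
  mul_mem' := by
    rintro F G ⟨hF, hF'⟩ ⟨hG, hG'⟩
    refine ⟨fun s' hs' ↦ ?_, fun s' hs' ↦ ?_⟩
    · obtain ⟨s₁, hs₁, h₁⟩ := hG s' hs'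
      obtain ⟨s₂, hs₂, h₂⟩ := hG' s' hs'
      obtain ⟨s₃, hs₃, h₃⟩ := hF s₂ hs₂
      refine ⟨s₁ * s₃, mul_mem hs₁ hs₃, fun a b ↦ ?_⟩
      have e₁ := h₁ a (s₃ * b)
      have e₂ := (h₂ a _ (h₃ a (s₁ * b))).2
      rw [← mul_assoc] at e₁ e₂
      rw [mul_comm s₃] at e₂
      have := mul_mem e₁ e₂
      simp only [Pi.mul_apply, _root_.mul_inv_rev]
      convert this using 1
      group
    · obtain ⟨s₁, hs₁, h₁⟩ := hF' s' hs'
      obtain ⟨s₂, hs₂, h₂⟩ := hG' s' hs'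
      obtain ⟨s₃, hs₃, h₃⟩ := hG' s₁ hs₁
      obtain ⟨s₄, hs₄, h₄⟩ := hF' s₂ hs₂
      refine ⟨s₃ * s₄, mul_mem hs₃ hs₄, fun a g hg ↦ ⟨?_, ?_⟩⟩
      · have := (h₁ a _ (h₃ a _ (cong_anti φ (Dvd.intro _ rfl) hg)).1).1
        simpa [mul_assoc] using this
      · have := (h₂ a _ (h₄ a _ (cong_anti φ (Dvd.intro_left _ rfl) hg)).2).2
        simpa [mul_assoc] using this
  inv_mem' := by
    rintro F ⟨hF, hF'⟩
    refine ⟨fun s' hs' ↦ ?_, fun s' hs' ↦ ?_⟩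
    · obtain ⟨s₁, hs₁, h₁⟩ := hF' s' hs'
      obtain ⟨s₂, hs₂, h₂⟩ := hF s₁ hs₁
      refine ⟨s₂, hs₂, fun a b ↦ ?_⟩
      have := inv_mem (h₁ (a + s₂ * b) _ (h₂ a b)).1
      simpa [mul_assoc] using this
    · obtain ⟨s, hs, h⟩ := hF' s' hs'
      exact ⟨s, hs, fun a g hg ↦ ⟨by simpa using (h a g hg).2, by simpa using (h a g hg).1⟩⟩

open Polynomial in
theorem exists_common_denominator (φ : T →+* L) (M : Submonoid T)
    (hden : ∀ x : L, ∃ t ∈ M, ∃ c, φ t * x = φ c) (β : L[X]) :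
    ∃ t ∈ M, ∃ β' : T[X], C (φ t) * β = β'.map φ := by
  induction β using Polynomial.induction_on' with
  | add p q hp hq =>
    obtain ⟨t, ht, p', hp'⟩ := hp
    obtain ⟨u, hu, q', hq'⟩ := hq
    refine ⟨t * u, mul_mem ht hu, C u * p' + C t * q', ?_⟩
    simp only [map_mul, Polynomial.map_add, Polynomial.map_mul, map_C, ← hp', ← hq']
    ring
  | monomial n x =>
    obtain ⟨t, ht, c, hc⟩ := hden x
    exact ⟨t, ht, monomial n c, by simp [C_mul_monomial, hc]⟩

open Polynomial in
theorem exists_forall_map_eq (hm : 3 ≤ m) (φ : T →+* L) (M : Submonoid T)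
    (hunit : ∀ s ∈ M, IsUnit (φ s)) (hden : ∀ x : L, ∃ t ∈ M, ∃ c, φ t * x = φ c)
    {σ : SpecialLinearGroup (Fin m) L[X]} (hσ : σ ∈ ElemSubgroup m L[X]) :
    ∃ s ∈ M, ∀ a b : T, ∃ ε ∈ ElemSubgroup m T, SpecialLinearGroup.map φ ε =
      (SpecialLinearGroup.map (evalRingHom (φ (a + s * b))) σ)⁻¹ *
        SpecialLinearGroup.map (evalRingHom (φ a)) σ := by
  let ev : SpecialLinearGroup (Fin m) L[X] →* (T → SpecialLinearGroup (Fin m) L) :=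
    MonoidHom.pi fun a ↦ SpecialLinearGroup.map (evalRingHom (φ a))
  have hle : ElemSubgroup m L[X] ≤ (uniform m φ M).comap ev := by
    refine le_of_transvection_mem fun k l hkl β ↦ ?_
    obtain ⟨t, ht, β', hβ⟩ := exists_common_denominator φ M hden β
    have hev (a : T) : φ t * β.eval (φ a) = φ (β'.eval a) := by
      have := congrArg (eval (φ a)) hβ
      simpa [eval_map_apply] using this
    have hevF (a : T) : ev (transvection hkl β) a = transvection hkl (β.eval (φ a)) := by
      simp [ev, map_transvection]
    refine ⟨fun s' hs' ↦ ⟨s' * t, mul_mem hs' ht, fun a b ↦ ?_⟩,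
      fun s' hs' ↦ ⟨(s' * t) ^ 2, pow_mem (mul_mem hs' ht) 2, fun a g hg ↦ ?_⟩⟩
    · simp only [hevF, transvection_inv, ← transvection_add]
      obtain ⟨d, hd⟩ := Polynomial.sub_dvd_eval_sub a (a + s' * t * b) β'
      refine transvection_mem_cong φ hkl (c := -(b * d)) ?_
      refine (hunit t ht).mul_left_cancel ?_
      have h₁ : s' * t * b * d = β'.eval (a + s' * t * b) - β'.eval a := by
        rw [← neg_inj, neg_sub, hd]; ring
      rw [mul_add, mul_neg, hev, hev, ← map_mul, ← map_neg, ← map_add]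
      congr 1
      linear_combination h₁
    · simp only [hevF]
      refine ⟨conj_mem_cong hm φ s' (hev a) hkl hg, ?_⟩
      have h := conj_mem_cong hm φ s' (c₀ := -(β'.eval a)) (x := -β.eval (φ a))
        (by rw [mul_neg, hev, map_neg]) hkl hg
      simpa only [← transvection_inv, inv_inv] using h
  obtain ⟨s, hs, h⟩ := (hle hσ).1 1 (one_mem M)
  exact ⟨s, hs, fun a b ↦ exists_map_eq_of_mem_cong φ (h a b)⟩

end Dilation

end ElemSubgroup

namespace ElemSubgroup

section LocalGlobal

open Polynomial

variable {m : ℕ} {R : Type*} [CommRing R]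

theorem map_mul_map {m : ℕ} {ι S S' : Type*} [CommRing S] [CommRing S'] (f : S →+* S')
    (g : SpecialLinearGroup (Fin m) S) (V : Matrix (Fin m) ι S) :
    ((g : Matrix (Fin m) (Fin m) S) * V).map f =
      (SpecialLinearGroup.map f g : Matrix (Fin m) (Fin m) S') * V.map f :=
  Matrix.map_mul

theorem exists_mul_eq_comp [IsDomain R] (hm : 3 ≤ m) {ι : Type*} (V : Matrix (Fin m) ι R[X])
    (P : Ideal R) [P.IsPrime]
    {Q : Type*} [CommRing Q] [Algebra R Q] [IsLocalization.AtPrime Q P]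
    {σ : SpecialLinearGroup (Fin m) Q[X]}
    (hσ : σ ∈ ElemSubgroup m Q[X])
    {V₀ : Matrix (Fin m) ι Q}
    (hV : (σ : Matrix (Fin m) (Fin m) Q[X]) *
      V.map (mapRingHom (algebraMap R Q)) = V₀.map C) :
    ∃ s ∉ P, ∀ a b : R[X], ∃ ε ∈ ElemSubgroup m R[X],
      (ε : Matrix (Fin m) (Fin m) R[X]) * V.map (compRingHom a) =
        V.map (compRingHom (a + C s * b)) := by
  set φ : R[X] →+* Q[X] := mapRingHom (algebraMap R Q) with hφ
  have hinj : Function.Injective φ :=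
    map_injective _ (IsLocalization.injective Q P.primeCompl_le_nonZeroDivisors)
  obtain ⟨_, ⟨s, hs, rfl⟩, h⟩ := exists_forall_map_eq hm φ (P.primeCompl.map (C : R →+* R[X]))
    (by
      rintro _ ⟨s, hs, rfl⟩
      simpa [hφ] using (IsLocalization.map_units Q (⟨s, hs⟩ : P.primeCompl)).map C)
    (fun x ↦ by
      obtain ⟨t, ht, c, hc⟩ := exists_common_denominator (algebraMap R Q) P.primeCompl
        (fun y ↦ by
          obtain ⟨⟨r, t⟩, hrt⟩ := IsLocalization.surj P.primeCompl y
          exact ⟨t, t.2, r, by rw [mul_comm]; exact hrt⟩) x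
      exact ⟨C t, ⟨t, ht, rfl⟩, c, by simpa [hφ] using hc⟩)
    (map_mem (mapRingHom (C : Q →+* Q[X])) hσ)
  refine ⟨s, hs, fun a b ↦ ?_⟩
  obtain ⟨ε, hε, hεσ⟩ := h a b
  refine ⟨ε, hε, ?_⟩
  have key (a : R[X]) : (SpecialLinearGroup.map (compRingHom (φ a)) σ : Matrix _ _ Q[X]) *
      (V.map (compRingHom a)).map φ = V₀.map C := by
    have := congrArg (fun A ↦ A.map (compRingHom (φ a))) hV
    simp only [map_mul_map] at this
    convert this using 1
    · congr 1
      ext i j : 2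
      simp [hφ, map_comp]
    · ext i j : 2
      simp
  have hcomp (a : R[X]) : SpecialLinearGroup.map (evalRingHom (φ a))
      (SpecialLinearGroup.map (mapRingHom (C : Q →+* Q[X])) σ) =
        SpecialLinearGroup.map (compRingHom (φ a)) σ := by
    ext i j : 2
    simp [Polynomial.comp, eval₂_eq_eval_map]
  rw [hcomp, hcomp] at hεσ
  refine Matrix.map_injective hinj ?_
  have hcancel (τ τ' : SpecialLinearGroup (Fin m) Q[X]) (W W' : Matrix (Fin m) ι Q[X])
      (h : (τ' : Matrix (Fin m) (Fin m) Q[X]) * W = (τ : Matrix (Fin m) (Fin m) Q[X]) * W') :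
      ((τ⁻¹ * τ' : SpecialLinearGroup (Fin m) Q[X]) : Matrix (Fin m) (Fin m) Q[X]) * W = W' := by
    rw [Matrix.SpecialLinearGroup.coe_mul, Matrix.mul_assoc, h, ← Matrix.mul_assoc,
      ← Matrix.SpecialLinearGroup.coe_mul, inv_mul_cancel, Matrix.SpecialLinearGroup.coe_one,
      Matrix.one_mul]
  refine (map_mul_map φ ε _).trans ?_
  rw [hεσ]
  exact hcancel _ _ _ _ ((key a).trans (key _).symm)

/-- Local-global principle: if `V` is locally equivalent to a constant matrix, then it is
globally equivalent to its value at zero. -/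
theorem exists_mul_eq_eval_zero [IsDomain R] (hm : 3 ≤ m) {ι : Type*} (V : Matrix (Fin m) ι R[X])
    (hloc : ∀ (P : Ideal R) [P.IsMaximal],
      ∃ σ ∈ ElemSubgroup m (Localization.AtPrime P)[X],
        ∃ V₀ : Matrix (Fin m) ι (Localization.AtPrime P),
          (σ : Matrix (Fin m) (Fin m) (Localization.AtPrime P)[X]) *
            V.map (mapRingHom (algebraMap R (Localization.AtPrime P))) = V₀.map C) :
    ∃ ε ∈ ElemSubgroup m R[X],
      (ε : Matrix (Fin m) (Fin m) R[X]) * V = (V.map (evalRingHom 0)).map C := by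
  let J : Ideal R :=
    { carrier := { s | ∀ a b : R[X], ∃ ε ∈ ElemSubgroup m R[X],
        (ε : Matrix (Fin m) (Fin m) R[X]) * V.map (compRingHom a) =
          V.map (compRingHom (a + C s * b)) }
      zero_mem' := fun a b ↦ ⟨1, one_mem _, by simp⟩
      add_mem' := by
        intro s t hs ht a b
        obtain ⟨ε, hε, h⟩ := hs a b
        obtain ⟨ε', hε', h'⟩ := ht (a + C s * b) b
        refine ⟨ε' * ε, mul_mem hε' hε, ?_⟩
        change ((ε' : Matrix (Fin m) (Fin m) R[X]) * (ε : Matrix (Fin m) (Fin m) R[X])) *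
          V.map (compRingHom a) = _
        rw [Matrix.mul_assoc, h, h', map_add, add_mul, add_assoc]
      smul_mem' := by
        intro r s hs a b
        obtain ⟨ε, hε, h⟩ := hs a (C r * b)
        refine ⟨ε, hε, h.trans ?_⟩
        rw [smul_eq_mul, map_mul, mul_comm (C r) (C s), mul_assoc] }
  have hJ : J = ⊤ := by
    by_contra hne
    obtain ⟨P, hP, hle⟩ := Ideal.exists_le_maximal J hne
    obtain ⟨σ, hσ, V₀, hV⟩ := hloc P
    obtain ⟨s, hs, h⟩ := exists_mul_eq_comp hm V P hσ hV
    exact hs (hle h)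
  have h1 : (1 : R) ∈ J := hJ ▸ Submodule.mem_top
  obtain ⟨ε, hε, h⟩ := h1 X (-X)
  refine ⟨ε, hε, ?_⟩
  convert h using 1
  · congr 1
    ext i j : 2
    simp
  · ext i j : 2
    simp

end LocalGlobal

end ElemSubgroup

namespace ElemSubgroup

section Column

variable {m : ℕ} {S S' : Type*} [CommRing S] [CommRing S']

/-- Two columns are equivalent if an elementary matrix carries one to the other. -/
def ColEquiv (v w : Fin m → S) : Prop :=
  ∃ ε ∈ ElemSubgroup m S, (ε : Matrix (Fin m) (Fin m) S) *ᵥ v = w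

namespace ColEquiv

variable {u v w : Fin m → S}

theorem refl (v : Fin m → S) : ColEquiv v v := ⟨1, one_mem _, by simp⟩

theorem trans (h : ColEquiv u v) (h' : ColEquiv v w) : ColEquiv u w := by
  obtain ⟨ε, hε, rfl⟩ := h
  obtain ⟨ε', hε', rfl⟩ := h'
  exact ⟨ε' * ε, mul_mem hε' hε, by
    rw [Matrix.SpecialLinearGroup.coe_mul, Matrix.mulVec_mulVec]⟩

theorem symm (h : ColEquiv u v) : ColEquiv v u := by
  obtain ⟨ε, hε, rfl⟩ := h
  exact ⟨ε⁻¹, inv_mem hε, by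
    rw [Matrix.mulVec_mulVec, ← Matrix.SpecialLinearGroup.coe_mul, inv_mul_cancel,
      Matrix.SpecialLinearGroup.coe_one, Matrix.one_mulVec]⟩

theorem map (f : S →+* S') (h : ColEquiv u v) : ColEquiv (f ∘ u) (f ∘ v) := by
  obtain ⟨ε, hε, rfl⟩ := h
  exact ⟨SpecialLinearGroup.map f ε, map_mem f hε, funext fun i ↦ (f.map_mulVec _ _ i).symm⟩

theorem exists_dotProduct_eq_one (h : ColEquiv u v) (hu : ∃ w, w ⬝ᵥ u = 1) :
    ∃ w, w ⬝ᵥ v = 1 := by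
  obtain ⟨ε, -, rfl⟩ := h.symm
  obtain ⟨w, hw⟩ := hu
  exact ⟨w ᵥ* (ε : Matrix (Fin m) (Fin m) S), by rwa [← Matrix.dotProduct_mulVec]⟩

theorem update_add_mul (v : Fin m → S) {i j : Fin m} (h : i ≠ j) (a : S) :
    ColEquiv v (Function.update v i (v i + a * v j)) := by
  refine ⟨Matrix.SpecialLinearGroup.transvection h a, transvection_mem h a, ?_⟩
  rw [Matrix.SpecialLinearGroup.transvection_coe, Matrix.add_mulVec, Matrix.one_mulVec]
  ext k
  rcases eq_or_ne k i with rfl | hk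
  · simp [Matrix.single_mulVec]
  · simp [Matrix.single_mulVec, hk]

theorem update_add_sum (v : Fin m → S) (i : Fin m) (c : Fin m → S) :
    ColEquiv v (fun j ↦ if j = i then v i else v j + c j * v i) := by
  suffices ∀ s : Finset (Fin m), i ∉ s →
      ColEquiv v (fun j ↦ if j ∈ s then v j + c j * v i else v j) by
    convert this (Finset.univ.erase i) (by simp) using 2 with j
    by_cases h : j = i <;> simp [h]
  intro s
  induction s using Finset.induction_on with
  | empty => simpa using refl v
  | insert l s hl ih =>
    intro hi
    have hil : l ≠ i := by rintro rfl; simp at hi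
    have his : i ∉ s := fun h ↦ hi (Finset.mem_insert_of_mem h)
    refine (ih his).trans ?_
    convert update_add_mul _ hil (c l) using 1
    ext j
    by_cases h : j = l
    · subst h; simp [hl, his]
    · simp [h]

theorem single_of_isUnit (hm : 2 ≤ m) {i : Fin m} (hv : IsUnit (v i)) (j : Fin m) :
    ColEquiv v (Pi.single j 1) := by
  have key {v : Fin m → S} {i : Fin m} (hv : v i = 1) : ColEquiv v (Pi.single i 1) := by
    convert update_add_sum v i (fun j ↦ -v j) using 1
    ext j
    by_cases h : j = i
    · subst h; simp [hv]
    · simp [h, hv]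
  have step {v : Fin m → S} {i j : Fin m} (hij : j ≠ i) (hv : IsUnit (v i)) :
      ColEquiv v (Pi.single j 1) := by
    obtain ⟨x, hx⟩ := hv.exists_left_inv
    refine (update_add_mul v hij ((1 - v j) * x)).trans (key ?_)
    rw [Function.update_self, mul_assoc, hx]; ring
  rcases eq_or_ne j i with rfl | hij
  · have : Nontrivial (Fin m) := Fin.nontrivial_iff_two_le.2 hm
    obtain ⟨l, hl⟩ := exists_ne j
    exact (step hl hv).trans (step hl.symm (by simp))
  · exact step hij hv

end ColEquiv

end Column

section Horrocks

open Polynomial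

variable {m : ℕ} {R : Type*} [CommRing R]

theorem degree_C_mul_le_degree (r : R) (h : R[X]) : (C r * h).degree ≤ h.degree := by
  rw [← smul_eq_C_mul]; exact degree_smul_le r h

theorem exists_mem_coeff_eq_one {J : Ideal R[X]} {f g : R[X]} (hf : f.Monic) (hfJ : f ∈ J)
    (hgJ : g ∈ J) (hg : g.degree < f.degree) {n : ℕ} (hn : IsUnit (g.coeff n)) :
    ∃ h ∈ J, h.degree < f.degree ∧ h.coeff (f.natDegree - 1) = 1 := by
  have : Nontrivial R := by
    by_contra! h
    exact hg.ne (by rw [Subsingleton.elim f g])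
  let I : Ideal R :=
    { carrier := { c | ∃ h ∈ J, h.degree < f.degree ∧ h.coeff (f.natDegree - 1) = c }
      zero_mem' := ⟨0, J.zero_mem, by
        rw [degree_zero, bot_lt_iff_ne_bot, Ne, degree_eq_bot]; exact hf.ne_zero, by simp⟩
      add_mem' := by
        rintro _ _ ⟨h, hJ, hd, rfl⟩ ⟨h', hJ', hd', rfl⟩
        exact ⟨h + h', J.add_mem hJ hJ', (degree_add_le _ _).trans_lt (max_lt hd hd'), by simp⟩
      smul_mem' := by
        rintro r _ ⟨h, hJ, hd, rfl⟩
        exact ⟨C r * h, J.mul_mem_left _ hJ, (degree_C_mul_le_degree _ _).trans_lt hd, by simp⟩ }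
  have hI (j : ℕ) : ∀ h ∈ J, h.degree < f.degree → j < f.natDegree →
      h.coeff (f.natDegree - 1 - j) ∈ I := by
    induction j with
    | zero => exact fun h hJ hd _ ↦ ⟨h, hJ, hd, rfl⟩
    | succ j ih =>
      intro h hJ hd hj
      have hdeg : (X * h - C (h.coeff (f.natDegree - 1)) * f).degree < f.degree := by
        rw [degree_eq_natDegree hf.ne_zero] at hd ⊢
        rw [degree_lt_iff_coeff_zero] at hd ⊢
        intro l hl
        obtain ⟨l, rfl⟩ : ∃ l', l = l' + 1 := ⟨l - 1, by omega⟩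
        rw [coeff_sub, coeff_X_mul, coeff_C_mul]
        rcases hl.eq_or_lt with hl | hl
        · rw [← hl, hf.coeff_natDegree, hl, Nat.add_sub_cancel, mul_one, sub_self]
        · rw [hd l (by omega), coeff_eq_zero_of_natDegree_lt hl, mul_zero, sub_zero]
      have h1 := ih _ (J.sub_mem (J.mul_mem_left _ hJ) (J.mul_mem_left _ hfJ)) hdeg (by omega)
      have h2 : h.coeff (f.natDegree - 1) ∈ I := ⟨h, hJ, hd, rfl⟩
      obtain ⟨l, hl⟩ : ∃ l, f.natDegree - 1 - j = l + 1 := ⟨f.natDegree - 1 - j - 1, by omega⟩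
      rw [hl, coeff_sub, coeff_X_mul, coeff_C_mul] at h1
      rw [show f.natDegree - 1 - (j + 1) = l by omega]
      simpa using I.add_mem h1 (I.mul_mem_right (f.coeff (l + 1)) h2)
  have hnf : n < f.natDegree := by
    by_contra! hle
    refine not_isUnit_zero (M₀ := R) ?_
    rwa [coeff_eq_zero_of_degree_lt] at hn
    exact hg.trans_le (degree_le_natDegree.trans (by exact_mod_cast hle))
  have := hI (f.natDegree - 1 - n) g hgJ hg (by omega)
  rw [show f.natDegree - 1 - (f.natDegree - 1 - n) = n by omega] at this
  have h1 : (1 : R) ∈ I := (Ideal.eq_top_iff_one I).1 (I.eq_top_of_isUnit_mem this hn)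
  exact h1

theorem exists_isUnit_coeff [IsLocalRing R] {v : Fin m → R[X]} (hv : ∃ w, w ⬝ᵥ v = 1) {i : Fin m}
    (hi : (v i).Monic) (hd : (v i).natDegree ≠ 0) : ∃ j ≠ i, ∃ n, IsUnit ((v j).coeff n) := by
  by_contra! hcon
  obtain ⟨w, hw⟩ := hv
  have hzero (j) (hj : j ≠ i) : (v j).map (IsLocalRing.residue R) = 0 := by
    ext n
    rw [coeff_map, coeff_zero, IsLocalRing.residue_eq_zero_iff, IsLocalRing.mem_maximalIdeal]
    exact hcon j hj n
  have h := congrArg (Polynomial.map (IsLocalRing.residue R)) hw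
  rw [dotProduct, Polynomial.map_sum, Finset.sum_eq_single i, Polynomial.map_mul,
    Polynomial.map_one] at h
  · have hunit : IsUnit ((v i).map (IsLocalRing.residue R)) := IsUnit.of_mul_eq_one_right _ h
    rw [(hi.map _).isUnit_iff] at hunit
    have := hi.natDegree_map (IsLocalRing.residue R)
    rw [hunit, natDegree_one] at this
    exact hd this.symm
  · intro j _ hj
    rw [Polynomial.map_mul, hzero j hj, mul_zero]
  · simp

/-- Over a local ring, a unimodular column of polynomials with a monic entry is elementarily
equivalent to any standard basis vector. -/
theorem ColEquiv.single_of_monic [IsLocalRing R] (hm : 3 ≤ m) {v : Fin m → R[X]}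
    (hv : ∃ w, w ⬝ᵥ v = 1) {i : Fin m} (hi : (v i).Monic) (j : Fin m) :
    ColEquiv v (Pi.single j 1) := by
  obtain ⟨d, hd⟩ : ∃ d, (v i).natDegree = d := ⟨_, rfl⟩
  induction d generalizing v i with
  | zero =>
    rw [hi.natDegree_eq_zero] at hd
    exact single_of_isUnit (by omega) (i := i) (by simp [hd]) j
  | succ d ih =>
    let v' : Fin m → R[X] := fun l ↦ if l = i then v i else v l + -(v l /ₘ v i) * v i
    have hvv' : ColEquiv v v' := update_add_sum v i fun l ↦ -(v l /ₘ v i)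
    have hv'i : v' i = v i := if_pos rfl
    have hv' (l) (hl : l ≠ i) : (v' l).degree < (v i).degree := by
      have : v' l = v l %ₘ v i := by
        rw [modByMonic_eq_sub_mul_div]; simp only [v', if_neg hl]; ring
      rw [this]; exact degree_modByMonic_lt _ hi
    have huni := hvv'.exists_dotProduct_eq_one hv
    obtain ⟨l, hl, n, hn⟩ := exists_isUnit_coeff (i := i) huni (hv'i ▸ hi) (by rw [hv'i]; omega)
    obtain ⟨h, hJ, hdeg, hcoeff⟩ := exists_mem_coeff_eq_one (J := Ideal.span {v i, v' l}) hi
      (Ideal.subset_span (by simp)) (Ideal.subset_span (by simp)) (hv' l hl) hn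
    obtain ⟨a, b, rfl⟩ := Ideal.mem_span_pair.1 hJ
    rw [hd, Nat.add_sub_cancel] at hcoeff
    obtain ⟨q, hiq, hql⟩ := exists_ne_ne hm i l
    let c := C (1 - (v' q).coeff d)
    have h1 := update_add_mul v' hiq.symm (c * a)
    have h2 := update_add_mul (Function.update v' q (v' q + c * a * v' i)) hql (c * b)
    have h3 := hvv'.trans (h1.trans h2)
    refine h3.trans ?_
    have hdq : (v' q + c * (a * v i + b * v' l)).degree < ((d + 1 : ℕ) : WithBot ℕ) := by
      rw [← hd, ← degree_eq_natDegree hi.ne_zero]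
      refine (degree_add_le _ _).trans_lt (max_lt (hv' q hiq.symm) ?_)
      exact (degree_C_mul_le_degree _ _).trans_lt hdeg
    have hcq : (v' q + c * (a * v i + b * v' l)).coeff d = 1 := by
      rw [coeff_add, coeff_C_mul, hcoeff]; ring
    have hle : (v' q + c * (a * v i + b * v' l)).natDegree ≤ d :=
      natDegree_le_iff_coeff_eq_zero.2 fun _ hN ↦ (degree_lt_iff_coeff_zero _ _).1 hdq _ hN
    have hmon := monic_of_natDegree_le_of_coeff_eq_one d hle hcq
    have heq : Function.update (Function.update v' q (v' q + c * a * v' i)) q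
        (Function.update v' q (v' q + c * a * v' i) q + c * b *
          Function.update v' q (v' q + c * a * v' i) l) q =
        v' q + c * (a * v i + b * v' l) := by
      simp only [Function.update_self, Function.update_of_ne hql.symm, hv'i]; ring
    refine ih (h3.exists_dotProduct_eq_one hv) (i := q) (by rwa [heq]) ?_
    rw [heq]
    exact hle.antisymm (le_natDegree_of_ne_zero (by simp [hcq]))

end Horrocks

end ElemSubgroup

namespace ElemSubgroup

section InE

variable {m : ℕ} {S : Type*} [CommRing S]

/-- A matrix is elementary if it is a product of transvections. -/
def InE (A : Matrix (Fin m) (Fin m) S) : Prop :=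
  ∃ g ∈ ElemSubgroup m S, (g : Matrix (Fin m) (Fin m) S) = A

namespace InE

variable {A B : Matrix (Fin m) (Fin m) S}

theorem mul (hA : InE A) (hB : InE B) : InE (A * B) := by
  obtain ⟨g, hg, rfl⟩ := hA
  obtain ⟨h, hh, rfl⟩ := hB
  exact ⟨g * h, mul_mem hg hh, Matrix.SpecialLinearGroup.coe_mul g h⟩

theorem of_mul_left (hA : InE A) (h : InE (A * B)) : InE B := by
  obtain ⟨g, hg, rfl⟩ := hA
  obtain ⟨h, hh, hgh⟩ := h
  refine ⟨g⁻¹ * h, mul_mem (inv_mem hg) hh, ?_⟩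
  rw [Matrix.SpecialLinearGroup.coe_mul, hgh, ← Matrix.mul_assoc,
    ← Matrix.SpecialLinearGroup.coe_mul, inv_mul_cancel, Matrix.SpecialLinearGroup.coe_one,
    Matrix.one_mul]

theorem of_mul_right (hB : InE B) (h : InE (A * B)) : InE A := by
  obtain ⟨g, hg, rfl⟩ := hB
  obtain ⟨h, hh, hgh⟩ := h
  refine ⟨h * g⁻¹, mul_mem hh (inv_mem hg), ?_⟩
  rw [Matrix.SpecialLinearGroup.coe_mul, hgh, Matrix.mul_assoc,
    ← Matrix.SpecialLinearGroup.coe_mul, mul_inv_cancel, Matrix.SpecialLinearGroup.coe_one,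
    Matrix.mul_one]

theorem transvection {i j : Fin m} (h : i ≠ j) (a : S) : InE (Matrix.transvection i j a) :=
  ⟨_, transvection_mem h a, rfl⟩

theorem coe_iff {g : SpecialLinearGroup (Fin m) S} :
    InE (g : Matrix (Fin m) (Fin m) S) ↔ g ∈ ElemSubgroup m S :=
  ⟨fun ⟨_, hh, h⟩ ↦ Subtype.ext h ▸ hh, fun h ↦ ⟨g, h, rfl⟩⟩

end InE

end InE

section Corner

variable {S : Type*} [CommRing S]

/-- The `3 × 3` matrix with lower right block `!![p, q; r, s]`. -/
def corner (p q r s : S) : Matrix (Fin 3) (Fin 3) S := !![1, 0, 0; 0, p, q; 0, r, s]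

theorem transvection_fin_three (x : S) :
    Matrix.transvection (0 : Fin 3) 1 x = !![1, x, 0; 0, 1, 0; 0, 0, 1] ∧
    Matrix.transvection (0 : Fin 3) 2 x = !![1, 0, x; 0, 1, 0; 0, 0, 1] ∧
    Matrix.transvection (1 : Fin 3) 2 x = !![1, 0, 0; 0, 1, x; 0, 0, 1] ∧
    Matrix.transvection (2 : Fin 3) 0 x = !![1, 0, 0; 0, 1, 0; x, 0, 1] ∧
    Matrix.transvection (2 : Fin 3) 1 x = !![1, 0, 0; 0, 1, 0; 0, x, 1] := by
  refine ⟨?_, ?_, ?_, ?_, ?_⟩ <;>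
  · ext i j
    fin_cases i <;> fin_cases j <;> simp [Matrix.transvection]

variable {p q r s : S}

theorem InE.corner_row_one (t : S) (h : InE (corner (p + t * r) (q + t * s) r s)) :
    InE (corner p q r s) := by
  refine of_mul_left (transvection (show (1 : Fin 3) ≠ 2 by decide) t) ?_
  convert h using 1
  rw [(transvection_fin_three t).2.2.1]
  simp [corner]

theorem InE.corner_row_two (t : S) (h : InE (corner p q (r + t * p) (s + t * q))) :
    InE (corner p q r s) := by
  refine of_mul_left (transvection (show (2 : Fin 3) ≠ 1 by decide) t) ?_
  convert h using 1
  rw [(transvection_fin_three t).2.2.2.2]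
  simp [corner, add_comm]

theorem InE.corner_col_one (t : S) (h : InE (corner (p + t * q) q (r + t * s) s)) :
    InE (corner p q r s) := by
  refine of_mul_right (transvection (show (2 : Fin 3) ≠ 1 by decide) t) ?_
  convert h using 1
  rw [(transvection_fin_three t).2.2.2.2]
  simp [corner, mul_comm]

theorem InE.corner_col_two (t : S) (h : InE (corner p (q + t * p) r (s + t * r))) :
    InE (corner p q r s) := by
  refine of_mul_right (transvection (show (1 : Fin 3) ≠ 2 by decide) t) ?_
  convert h using 1
  rw [(transvection_fin_three t).2.2.1]
  simp [corner, mul_comm, add_comm]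

theorem InE.corner_of_eq_one (hp : p = 1) (h : p * s - q * r = 1) : InE (corner p q r s) := by
  subst hp
  refine corner_col_two (-q) (corner_row_two (-r) ?_)
  refine ⟨1, one_mem _, ?_⟩
  ext i j
  fin_cases i <;> fin_cases j <;> simp [corner]
  linear_combination -h

theorem InE.corner_of_isUnit (hq : IsUnit q) (h : p * s - q * r = 1) :
    InE (corner p q r s) := by
  obtain ⟨u, hu⟩ := hq.exists_left_inv
  refine corner_col_one ((1 - p) * u) (corner_of_eq_one ?_ ?_)
  · linear_combination (1 - p) * hu
  · linear_combination h

/-- Multiplicativity of Mennicke symbols. -/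
theorem InE.corner_mul {a a' b c d : S} (h : a * a' * d - b * c = 1)
    (h₁ : InE (corner a b c (a' * d))) (h₂ : InE (corner a' (-b) (-c) (a * d))) :
    InE (corner (a * a') b c d) := by
  have e01 (x : S) := (transvection_fin_three x).1 ▸
    transvection (show (0 : Fin 3) ≠ 1 by decide) x
  have e02 (x : S) := (transvection_fin_three x).2.1 ▸
    transvection (show (0 : Fin 3) ≠ 2 by decide) x
  have e20 (x : S) := (transvection_fin_three x).2.2.2.1 ▸
    transvection (show (2 : Fin 3) ≠ 0 by decide) x
  have hw := ((e20 1).mul (e02 (-1))).mul (e20 1)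
  have hw' := ((e20 (-1)).mul (e02 1)).mul (e20 (-1))
  have h₂' : InE !![a * d, c, 0; b, a', 0; 0, 0, (1 : S)] := by
    convert (hw.mul h₂).mul hw' using 1
    simp [corner]
  have h₃ := ((((e02 (a * d)).mul (h₁.mul h₂')).mul (e20 (-a))).mul (e01 (c * a'))).mul
    (e02 (a' * d))
  convert (hw.mul (e01 (-(c * d)))).mul h₃ using 1
  simp only [corner, Matrix.mul_fin_three]
  ext i j
  fin_cases i <;> fin_cases j <;> simp <;> grind

end Corner

section Mennicke

open Polynomial

variable {R : Type*} [CommRing R] {p q r s : R[X]}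

theorem InE.corner_of_isUnit_coeff_zero [Nontrivial R]
    (ih : ∀ p' q' r' s' : R[X], p'.Monic → p'.natDegree < p.natDegree →
      p' * s' - q' * r' = 1 → InE (corner p' q' r' s'))
    (hp : p.Monic) (hq : q.natDegree < p.natDegree) (hu : IsUnit (q.coeff 0))
    (h : p * s - q * r = 1) : InE (corner p q r s) := by
  obtain ⟨u, hu'⟩ := hu.exists_left_inv
  refine corner_col_one (-C (p.coeff 0 * u)) ?_
  have hdeg : (-C (p.coeff 0 * u) * q).degree < p.degree := by
    rw [neg_mul, degree_neg]
    exact (degree_C_mul_le_degree _ _).trans_lt (degree_lt_degree hq)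
  have hmon := hp.add_of_left hdeg
  have hnat := natDegree_eq_of_degree_eq (degree_add_eq_left_of_degree_lt hdeg)
  obtain ⟨p', hp'⟩ : X ∣ p + -C (p.coeff 0 * u) * q := by
    rw [X_dvd_iff]
    simp only [coeff_add, neg_mul, coeff_neg, coeff_C_mul]
    linear_combination (-p.coeff 0) * hu'
  have h' : X * p' * s - q * (r + -C (p.coeff 0 * u) * s) = 1 := by
    rw [← hp']; linear_combination h
  rw [hp'] at hmon hnat ⊢
  have hmon' := monic_X.of_mul_monic_left hmon
  rw [natDegree_X_mul hmon'.ne_zero] at hnat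
  refine corner_mul h' ?_ (ih _ _ _ _ hmon' (by omega) (by linear_combination h'))
  obtain ⟨q', hq'⟩ : X ∣ q - C (q.coeff 0) := by rw [X_dvd_iff]; simp
  refine corner_col_two (-q') (corner_of_isUnit ?_ (by linear_combination h'))
  convert hu.map C using 1
  linear_combination hq'

/-- Over a local ring, `!![p, q; r, s]` becomes elementary in size three if `p` is monic. -/
theorem InE.corner_of_monic [IsLocalRing R] (hp : p.Monic) (h : p * s - q * r = 1) :
    InE (corner p q r s) := by
  obtain ⟨n, hn⟩ : ∃ n, p.natDegree = n := ⟨_, rfl⟩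
  induction n using Nat.strong_induction_on generalizing p q r s with
  | _ n ih =>
  subst hn
  by_cases hp1 : p = 1
  · exact corner_of_eq_one hp1 h
  replace ih : ∀ p' q' r' s' : R[X], p'.Monic → p'.natDegree < p.natDegree →
      p' * s' - q' * r' = 1 → InE (corner p' q' r' s') :=
    fun p' q' r' s' hp' hlt h' ↦ ih _ hlt hp' h' rfl
  have hpos : 0 < p.natDegree := by
    rw [Nat.pos_iff_ne_zero, Ne, hp.natDegree_eq_zero]; exact hp1
  refine corner_col_two (-(q /ₘ p)) (corner_row_two (-(r /ₘ p)) ?_)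
  have hq : q + -(q /ₘ p) * p = q %ₘ p := by rw [modByMonic_eq_sub_mul_div]; ring
  have hr : r + -(r /ₘ p) * p = r %ₘ p := by rw [modByMonic_eq_sub_mul_div]; ring
  have hqd := natDegree_modByMonic_lt q hp hp1
  have hrd := natDegree_modByMonic_lt r hp hp1
  rw [← hq] at hqd
  rw [← hr] at hrd
  have h' : p * (s + -(q /ₘ p) * r + -(r /ₘ p) * (q + -(q /ₘ p) * p)) -
      (q + -(q /ₘ p) * p) * (r + -(r /ₘ p) * p) = 1 := by linear_combination h
  generalize s + -(q /ₘ p) * r + -(r /ₘ p) * (q + -(q /ₘ p) * p) = s at h' ⊢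
  generalize q + -(q /ₘ p) * p = q at *
  generalize r + -(r /ₘ p) * p = r at *
  by_cases hu : IsUnit (q.coeff 0)
  · exact corner_of_isUnit_coeff_zero ih hp hqd hu h'
  have hsd : s.natDegree < p.natDegree := by
    by_contra! hle
    have hs : s ≠ 0 := by rintro rfl; simp at hle; omega
    have h1 : (p * s).natDegree = p.natDegree + s.natDegree := hp.natDegree_mul' hs
    have h2 : p * s = q * r + 1 := by linear_combination h'
    have h3 : (q * r + 1).natDegree ≤ q.natDegree + r.natDegree := by
      refine (natDegree_add_le _ _).trans ?_
      simpa using natDegree_mul_le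
    rw [h2] at h1
    omega
  have hu' : IsUnit ((q + 1 * s).coeff 0) := by
    have h0 : p.coeff 0 * s.coeff 0 = 1 + q.coeff 0 * r.coeff 0 := by
      have := congrArg (fun f ↦ f.coeff 0) h'
      simp only [coeff_sub, mul_coeff_zero, coeff_one_zero] at this
      linear_combination this
    have hmem : q.coeff 0 ∈ IsLocalRing.maximalIdeal R := hu
    have h1 : IsUnit (p.coeff 0 * s.coeff 0) := by
      by_contra hnu
      have := Ideal.sub_mem _ (show p.coeff 0 * s.coeff 0 ∈ IsLocalRing.maximalIdeal R from hnu)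
        (Ideal.mul_mem_right (r.coeff 0) _ hmem)
      rw [h0, add_sub_cancel_right] at this
      exact this isUnit_one
    by_contra hnu
    have := Ideal.sub_mem _ (show (q + 1 * s).coeff 0 ∈ IsLocalRing.maximalIdeal R from hnu) hmem
    rw [one_mul, coeff_add, add_sub_cancel_left] at this
    exact this (isUnit_of_mul_isUnit_right h1)
  have hpr : (p + 1 * r).natDegree = p.natDegree := by
    rw [one_mul]; exact natDegree_add_eq_left_of_natDegree_lt hrd
  refine corner_row_one 1 (corner_of_isUnit_coeff_zero (by rwa [hpr]) ?_ ?_ hu'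
    (by linear_combination h'))
  · rw [one_mul]; exact hp.add_of_left (degree_lt_degree hrd)
  · rw [hpr, one_mul]
    exact (natDegree_add_le _ _).trans_lt (max_lt hqd hsd)

end Mennicke

end ElemSubgroup

namespace ElemSubgroup

section Shear

open Polynomial MvPolynomial Ideal Nat RingHom List

variable {k : Type*} [Field k] {n : ℕ} (f : MvPolynomial (Fin (n + 1)) k)
variable (v w : Fin (n + 1) →₀ ℕ)

variable {f v} in
theorem lt_up (vlt : ∀ i, v i < 2 + f.totalDegree) : ∀ l ∈ ofFn v, l < 2 + f.totalDegree := by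
  grind

theorem t1_comp_t1_neg (c : k) :
    (NoetherNormalization.T1 f c).comp (NoetherNormalization.T1 f (-c)) = AlgHom.id _ _ := by
  rw [comp_aeval, ← MvPolynomial.aeval_X_left]
  ext i v
  cases i using Fin.cases <;> simp

/-- `NoetherNormalization.T1 f 1` leads to an algebra equiv `shear f`. -/
noncomputable abbrev shear :=
  AlgEquiv.ofAlgHom (NoetherNormalization.T1 f 1) (NoetherNormalization.T1 f (-1))
    (t1_comp_t1_neg f 1) (by simpa using t1_comp_t1_neg f (-1))

theorem sum_r_mul_ne (vlt : ∀ i, v i < 2 + f.totalDegree) (wlt : ∀ i, w i < 2 + f.totalDegree)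
    (ne : v ≠ w) :
    ∑ x : Fin (n + 1), (2 + f.totalDegree) ^ (x : ℕ) * v x ≠
      ∑ x : Fin (n + 1), (2 + f.totalDegree) ^ (x : ℕ) * w x := by
  intro h
  refine ne <| Finsupp.ext <| congrFun <| ofFn_inj.mp ?_
  apply ofDigits_inj_of_len_eq (Nat.lt_add_right f.totalDegree one_lt_two)
    (by simp) (lt_up vlt) (lt_up wlt)
  simpa only [ofDigits_eq_sum_mapIdx, mapIdx_eq_ofFn, get_ofFn, length_ofFn,
    Fin.val_cast, mul_comm, sum_ofFn] using! h

theorem degreeOf_zero_t {a : k} (ha : a ≠ 0) : ((shear f) (monomial v a)).degreeOf 0 =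
    ∑ i : Fin (n + 1), (2 + f.totalDegree) ^ (i : ℕ) * v i := by
  rw [← natDegree_finSuccEquiv, monomial_eq, Finsupp.prod_pow v fun a ↦ X a]
  simp only [Fin.prod_univ_succ, Fin.sum_univ_succ, map_mul, map_prod, map_pow,
    AlgEquiv.ofAlgHom_apply, MvPolynomial.aeval_C, MvPolynomial.aeval_X, if_pos, Fin.succ_ne_zero,
    ite_false, one_smul, map_add, finSuccEquiv_X_zero, finSuccEquiv_X_succ, algebraMap_eq]
  have h (i : Fin n) :
      (Polynomial.C (X (R := k) i) + Polynomial.X ^ ((2 + f.totalDegree) ^ (i.succ : ℕ))) ^ v i.succ ≠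
        0 :=
    pow_ne_zero (v i.succ) (leadingCoeff_ne_zero.mp <| by simp [add_comm, leadingCoeff_X_pow_add_C])
  rw [natDegree_mul (by simp [ha]) (mul_ne_zero (by simp) (Finset.prod_ne_zero_iff.mpr
    (fun i _ ↦ h i))), natDegree_mul (by simp) (Finset.prod_ne_zero_iff.mpr (fun i _ ↦ h i)),
    natDegree_prod _ _ (fun i _ ↦ h i), natDegree_finSuccEquiv, degreeOf_C]
  simpa only [natDegree_pow, zero_add, natDegree_X, mul_one, Fin.val_zero, pow_zero, one_mul,
    add_right_inj] using Finset.sum_congr rfl (fun i _ ↦ by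
    rw [add_comm (Polynomial.C _), natDegree_X_pow_add_C, mul_comm])

/-- `shear` maps different monomials of `f` to polynomials with different degrees in `X_0`. -/
theorem degreeOf_t_ne_of_ne (hv : v ∈ f.support) (hw : w ∈ f.support) (ne : v ≠ w) :
    (shear f <| monomial v <| coeff v f).degreeOf 0 ≠
    (shear f <| monomial w <| coeff w f).degreeOf 0 := by
  rw [degreeOf_zero_t _ _ <| mem_support_iff.mp hv, degreeOf_zero_t _ _ <| mem_support_iff.mp hw]
  refine sum_r_mul_ne f v w (fun i ↦ ?_) (fun i ↦ ?_) ne <;>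
  exact lt_of_le_of_lt ((monomial_le_degreeOf i ‹_›).trans (degreeOf_le_totalDegree f i))
    (by lia)

theorem leadingCoeff_finSuccEquiv_t :
    (finSuccEquiv k n ((shear f) ((monomial v) (coeff v f)))).leadingCoeff =
    algebraMap k _ (coeff v f) := by
  rw [monomial_eq, Finsupp.prod_fintype]
  · simp only [map_mul, map_prod, leadingCoeff_mul, leadingCoeff_prod]
    rw [AlgEquiv.ofAlgHom_apply, algHom_C, algebraMap_eq, finSuccEquiv_apply,
      eval₂Hom_C, coe_comp]
    simp only [AlgEquiv.ofAlgHom_apply, Function.comp_apply, leadingCoeff_C, map_pow,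
      leadingCoeff_pow, algebraMap_eq]
    have : ∀ j, ((finSuccEquiv k n) ((NoetherNormalization.T1 f) 1 (X j))).leadingCoeff = 1 :=
        fun j ↦ by
      by_cases h : j = 0
      · simp [h, finSuccEquiv_apply]
      · simp only [aeval_eq_bind₁, bind₁_X_right, if_neg h, one_smul, map_add, map_pow]
        obtain ⟨i, rfl⟩ := Fin.exists_succ_eq.mpr h
        simp [finSuccEquiv_X_succ, finSuccEquiv_X_zero, add_comm]
    simp only [this, one_pow, Finset.prod_const_one, mul_one]
  exact fun i ↦ pow_zero _

/-- `shear` maps `f` to a polynomial in `X_0` with invertible leading coefficient. -/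
theorem leadingCoeff_shear_isUnit (fne : f ≠ 0) :
    IsUnit (finSuccEquiv k n (shear f f)).leadingCoeff := by
  obtain ⟨v, vin, vs⟩ := Finset.exists_max_image f.support
    (fun v ↦ (shear f ((monomial v) (coeff v f))).degreeOf 0) (support_nonempty.mpr fne)
  set h := fun w ↦ (MvPolynomial.monomial w) (coeff w f)
  simp only [← natDegree_finSuccEquiv] at vs
  replace vs : ∀ x ∈ f.support \ {v}, (finSuccEquiv k n ((shear f) (h x))).degree <
      (finSuccEquiv k n ((shear f) (h v))).degree := by
    intro x hx
    obtain ⟨h1, h2⟩ := Finset.mem_sdiff.mp hx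
    apply degree_lt_degree <| lt_of_le_of_ne (vs x h1) ?_
    simpa only [natDegree_finSuccEquiv]
      using degreeOf_t_ne_of_ne f _ _ h1 vin <| ne_of_not_mem_cons h2
  have coeff : (finSuccEquiv k n ((shear f) (h v + ∑ x ∈ f.support \ {v}, h x))).leadingCoeff =
      (finSuccEquiv k n ((shear f) (h v))).leadingCoeff := by
    simp only [map_add, map_sum]
    rw [add_comm]
    apply leadingCoeff_add_of_degree_lt <| (lt_of_le_of_lt <| degree_sum_le _ _) ?_
    have h2 : h v ≠ 0 := by simpa [h] using mem_support_iff.mp vin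
    replace h2 : (finSuccEquiv k n ((shear f) (h v))) ≠ 0 := fun eq ↦ h2 <|
      by simpa only [map_eq_zero_iff _ (AlgEquiv.injective _)] using eq
    exact (Finset.sup_lt_iff <| Ne.bot_lt (fun x ↦ h2 <| degree_eq_bot.mp x)).mpr vs
  nth_rw 2 [← f.support_sum_monomial_coeff]
  rw [Finset.sum_eq_add_sum_sdiff_singleton_of_mem vin h]
  rw [leadingCoeff_finSuccEquiv_t] at coeff
  simpa only [coeff, algebraMap_eq] using (mem_support_iff.mp vin).isUnit.map MvPolynomial.C

end Shear

end ElemSubgroup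

namespace ElemSubgroup

section Border

variable {m : ℕ} {S S' : Type*} [CommRing S] [CommRing S']

theorem InE.map (f : S →+* S') {A : Matrix (Fin m) (Fin m) S} (h : InE A) : InE (A.map f) := by
  obtain ⟨g, hg, rfl⟩ := h
  exact ⟨SpecialLinearGroup.map f g, map_mem f hg, rfl⟩

/-- The block matrix with diagonal blocks `1` and `A`. -/
def border (A : Matrix (Fin m) (Fin m) S) : Matrix (Fin (m + 1)) (Fin (m + 1)) S :=
  Matrix.of (Fin.cons (Fin.cons 1 0) fun i ↦ Fin.cons 0 (A i))

section

variable (A B : Matrix (Fin m) (Fin m) S) (i j : Fin m)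

@[simp] theorem border_zero_zero : border A 0 0 = 1 := rfl
@[simp] theorem border_zero_succ : border A 0 j.succ = 0 := rfl
@[simp] theorem border_succ_zero : border A i.succ 0 = 0 := rfl
@[simp] theorem border_succ_succ : border A i.succ j.succ = A i j := rfl

theorem border_mul : border (A * B) = border A * border B := by
  ext i j
  cases i using Fin.cases <;> cases j using Fin.cases <;>
    simp [Matrix.mul_apply, Fin.sum_univ_succ]

theorem det_border : (border A).det = A.det := by
  rw [Matrix.det_succ_row_zero, Fin.sum_univ_succ]
  simp
  rfl

end

theorem border_one : border (1 : Matrix (Fin m) (Fin m) S) = 1 := by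
  ext i j
  cases i using Fin.cases <;> cases j using Fin.cases <;>
    simp [Matrix.one_apply, Fin.succ_ne_zero, (Fin.succ_ne_zero _).symm]

theorem InE.border {A : Matrix (Fin m) (Fin m) S} (h : InE A) : InE (border A) := by
  obtain ⟨g, hg, rfl⟩ := h
  induction hg using Subgroup.closure_induction with
  | mem g hg =>
    obtain ⟨i, j, a, hij, hg⟩ := hg
    rw [hg]
    convert transvection (i := i.succ) (j := j.succ) (by simpa using hij) a using 1
    ext k l
    cases k using Fin.cases <;> cases l using Fin.cases <;>
      simp [Matrix.transvection, Matrix.one_apply, Matrix.single_apply, Fin.succ_ne_zero,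
        (Fin.succ_ne_zero _).symm]
  | one =>
    rw [Matrix.SpecialLinearGroup.coe_one, border_one]
    exact ⟨1, one_mem _, rfl⟩
  | mul g h _ _ hg hh =>
    rw [Matrix.SpecialLinearGroup.coe_mul, border_mul]
    exact hg.mul hh
  | inv g _ hg =>
    refine of_mul_left hg ?_
    rw [← border_mul, ← Matrix.SpecialLinearGroup.coe_mul, mul_inv_cancel,
      Matrix.SpecialLinearGroup.coe_one, border_one]
    exact ⟨1, one_mem _, rfl⟩

theorem exists_inE_mul_apply (B : Matrix (Fin (m + 1)) (Fin (m + 1)) S) (c : Fin m → S) :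
    ∃ N : Matrix (Fin (m + 1)) (Fin (m + 1)) S, InE N ∧ (∀ i, (B * N) i 0 = B i 0) ∧
      ∀ i j, (B * N) i (Fin.succ j) = B i j.succ + c j * B i 0 := by
  suffices ∀ s : Finset (Fin m), ∃ N : Matrix (Fin (m + 1)) (Fin (m + 1)) S, InE N ∧
      (∀ i, (B * N) i 0 = B i 0) ∧
      ∀ i j, (B * N) i (Fin.succ j) = B i j.succ + if j ∈ s then c j * B i 0 else 0 by
    simpa using this Finset.univ
  intro s
  induction s using Finset.induction_on with
  | empty => exact ⟨1, ⟨1, one_mem _, rfl⟩, by simp, by simp⟩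
  | insert l s hl ih =>
    obtain ⟨N, hN, h0, h⟩ := ih
    refine ⟨N * Matrix.transvection 0 l.succ (c l),
      hN.mul (.transvection (Fin.succ_ne_zero l).symm _), fun i ↦ ?_, fun i j ↦ ?_⟩
    · rw [← Matrix.mul_assoc, Matrix.mul_transvection_apply_of_ne _ _ _ _
        (Fin.succ_ne_zero l).symm, h0]
    · rw [← Matrix.mul_assoc]
      rcases eq_or_ne j l with rfl | hj
      · rw [Matrix.mul_transvection_apply_same, h0, h]
        simp [hl]
      · rw [Matrix.mul_transvection_apply_of_ne _ _ _ _ (by simpa using hj), h]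
        simp [hj]

theorem mem_of_colEquiv (g : SpecialLinearGroup (Fin (m + 1)) S)
    (hcol : ColEquiv (fun i ↦ (g : Matrix (Fin (m + 1)) (Fin (m + 1)) S) i 0) (Pi.single 0 1))
    (hA : ∀ A : Matrix (Fin m) (Fin m) S, A.det = 1 → InE (border A)) :
    g ∈ ElemSubgroup (m + 1) S := by
  obtain ⟨ε, hε, hcol⟩ := hcol
  rw [← InE.coe_iff]
  refine InE.of_mul_left ⟨ε, hε, rfl⟩ ?_
  rw [← Matrix.SpecialLinearGroup.coe_mul]
  set B := ε * g with hB
  have hB0 (i) : (B : Matrix (Fin (m + 1)) (Fin (m + 1)) S) i 0 =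
      (Pi.single 0 1 : Fin (m + 1) → S) i := by
    rw [← hcol, hB, Matrix.SpecialLinearGroup.coe_mul]; rfl
  obtain ⟨N, hN, h0, h⟩ := exists_inE_mul_apply (B : Matrix (Fin (m + 1)) (Fin (m + 1)) S)
    (fun j ↦ -(B : Matrix (Fin (m + 1)) (Fin (m + 1)) S) 0 j.succ)
  refine InE.of_mul_right hN ?_
  have heq : (B : Matrix (Fin (m + 1)) (Fin (m + 1)) S) * N =
      border (((B : Matrix (Fin (m + 1)) (Fin (m + 1)) S) * N).submatrix Fin.succ Fin.succ) := by
    ext i j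
    cases i using Fin.cases <;> cases j using Fin.cases <;> simp [h0, h, hB0]
  rw [heq]
  refine hA _ ?_
  rw [← det_border, ← heq, Matrix.det_mul, Matrix.SpecialLinearGroup.det_coe]
  obtain ⟨N, -, rfl⟩ := hN
  simp

theorem exists_dotProduct_col_eq_one (g : SpecialLinearGroup (Fin m) S) (j : Fin m) :
    ∃ w, (w ⬝ᵥ fun i ↦ (g : Matrix (Fin m) (Fin m) S) i j) = 1 := by
  refine ⟨fun i ↦ (g⁻¹ : SpecialLinearGroup (Fin m) S).1 j i, ?_⟩
  have : ((g⁻¹ * g : SpecialLinearGroup (Fin m) S) : Matrix (Fin m) (Fin m) S) j j = 1 := by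
    simp
  rwa [Matrix.SpecialLinearGroup.coe_mul, Matrix.mul_apply] at this

theorem exists_ne_zero_of_dotProduct_eq_one [Nontrivial S] {v : Fin m → S}
    (hv : ∃ w, w ⬝ᵥ v = 1) : ∃ i, v i ≠ 0 := by
  by_contra! h
  obtain ⟨w, hw⟩ := hv
  rw [show v = 0 from funext h, dotProduct_zero] at hw
  exact zero_ne_one hw

end Border

end ElemSubgroup

namespace ElemSubgroup

section Poly

open Polynomial

variable {m : ℕ} {R S S' : Type*} [CommRing R] [CommRing S] [CommRing S']

theorem exists_dotProduct_map (f : S →+* S') {v : Fin m → S} (hv : ∃ w, w ⬝ᵥ v = 1) :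
    ∃ w, w ⬝ᵥ (f ∘ v) = 1 := by
  obtain ⟨w, hw⟩ := hv
  exact ⟨f ∘ w, by rw [← f.map_dotProduct, hw, map_one]⟩

theorem comp_single_one (f : S →+* S') (j : Fin m) :
    f ∘ (Pi.single j 1 : Fin m → S) = Pi.single j 1 := by
  ext l
  rcases eq_or_ne l j with rfl | h
  · simp
  · simp [h]

theorem ColEquiv.single_of_ringEquiv (e : S ≃+* S') {v : Fin m → S} {j : Fin m}
    (h : ColEquiv (e ∘ v) (Pi.single j 1)) : ColEquiv v (Pi.single j 1) := by
  have := h.map (e.symm : S' →+* S)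
  rw [comp_single_one] at this
  convert this using 1
  ext l
  simp

theorem corner_map (f : S →+* S') (p q r s : S) :
    (corner p q r s).map f = corner (f p) (f q) (f r) (f s) := by
  ext i j
  fin_cases i <;> fin_cases j <;> simp [corner]

theorem InE.corner_of_ringEquiv (e : S ≃+* S') {p q r s : S}
    (h : InE (corner (e p) (e q) (e r) (e s))) : InE (corner p q r s) := by
  have := h.map (e.symm : S' →+* S)
  rw [corner_map] at this
  simpa using this

/-- Horrocks-type descent for unimodular columns with a monic entry. -/
theorem ColEquiv.single_of_monic_of_forall [IsDomain R] (hm : 3 ≤ m) (j : Fin m)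
    (hR : ∀ v : Fin m → R, (∃ w, w ⬝ᵥ v = 1) → ColEquiv v (Pi.single j 1))
    {v : Fin m → R[X]} (hv : ∃ w, w ⬝ᵥ v = 1) {i : Fin m} (hi : (v i).Monic) :
    ColEquiv v (Pi.single j 1) := by
  obtain ⟨ε, hε, h⟩ := exists_mul_eq_eval_zero hm (Matrix.of fun i (_ : Unit) ↦ v i)
    (fun P _ ↦ by
      let φ := mapRingHom (algebraMap R (Localization.AtPrime P))
      obtain ⟨σ, hσ, h⟩ := single_of_monic hm (v := φ ∘ v) (exists_dotProduct_map φ hv) (i := i)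
        (hi.map _) j
      refine ⟨σ, hσ, Matrix.of fun i _ ↦ (Pi.single j 1 : Fin m → _) i, ?_⟩
      ext1 l u
      refine (congrFun h l).trans ?_
      exact congrFun (comp_single_one (C : _ →+* (Localization.AtPrime P)[X]) j).symm l)
  have h1 : ColEquiv v (C ∘ (evalRingHom 0 ∘ v)) :=
    ⟨ε, hε, funext fun l ↦ congrFun (congrFun h l) ()⟩
  have h2 := (hR _ (exists_dotProduct_map (evalRingHom 0) hv)).map (C : R →+* R[X])
  rw [comp_single_one] at h2
  exact h1.trans h2

theorem InE.corner_of_monic_of_forall [IsDomain R]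
    (hR : ∀ p q r s : R, p * s - q * r = 1 → InE (corner p q r s))
    {p q r s : R[X]} (hp : p.Monic) (h : p * s - q * r = 1) : InE (corner p q r s) := by
  obtain ⟨ε, hε, h'⟩ := exists_mul_eq_eval_zero le_rfl (corner p q r s)
    (fun P _ ↦ by
      let φ := mapRingHom (algebraMap R (Localization.AtPrime P))
      obtain ⟨σ, hσ, hσ'⟩ := corner_of_monic (p := φ p) (q := φ q) (r := φ r) (s := φ s)
        (hp.map _) (by rw [← map_mul, ← map_mul, ← map_sub, h, map_one])
      refine ⟨σ⁻¹, inv_mem hσ, 1, ?_⟩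
      rw [corner_map, ← hσ', ← Matrix.SpecialLinearGroup.coe_mul, inv_mul_cancel]
      simp)
  refine of_mul_left ⟨ε, hε, rfl⟩ ?_
  rw [h', corner_map]
  refine (hR _ _ _ _ ?_).map C
  rw [← map_mul, ← map_mul, ← map_sub, h, map_one]

theorem exists_monic_add [Nontrivial R] {f : R[X]} (hf : IsUnit f.leadingCoeff) (g : R[X]) :
    ∃ t, (g + t * f).Monic := by
  obtain ⟨u, hu⟩ := hf.exists_left_inv
  have h1 : (C u * f).Monic := by
    apply monic_C_mul_of_mul_leadingCoeff_eq_one hu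
  have h2 : (X ^ (g.natDegree + 1) * (C u * f)).Monic := (monic_X_pow _).mul h1
  refine ⟨X ^ (g.natDegree + 1) * C u, ?_⟩
  rw [mul_assoc]
  refine h2.add_of_right (degree_lt_degree ?_)
  rw [(monic_X_pow _).natDegree_mul h1, natDegree_X_pow]
  omega

variable {k : Type*} [Field k]

theorem exists_ringEquiv_isUnit_leadingCoeff {p : ℕ} {f : MvPolynomial (Fin (p + 1)) k}
    (hf : f ≠ 0) : ∃ e : MvPolynomial (Fin (p + 1)) k ≃+* (MvPolynomial (Fin p) k)[X],
      IsUnit (e f).leadingCoeff :=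
  ⟨((shear f).trans (MvPolynomial.finSuccEquiv k p)).toRingEquiv,
    leadingCoeff_shear_isUnit f hf⟩

theorem isUnit_mvPolynomial_fin_zero {f : MvPolynomial (Fin 0) k} (hf : f ≠ 0) : IsUnit f := by
  have : IsUnit (MvPolynomial.isEmptyRingEquiv k (Fin 0) f) := by
    rw [isUnit_iff_ne_zero]
    exact (map_ne_zero_iff _ (RingEquiv.injective _)).2 hf
  exact (MulEquiv.isUnit_map _).1 this

theorem ColEquiv.single_of_mvPolynomial (hm : 3 ≤ m) (j : Fin m) {p : ℕ}
    {v : Fin m → MvPolynomial (Fin p) k} (hv : ∃ w, w ⬝ᵥ v = 1) :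
    ColEquiv v (Pi.single j 1) := by
  induction p with
  | zero =>
    obtain ⟨i, hi⟩ := exists_ne_zero_of_dotProduct_eq_one hv
    exact single_of_isUnit (by omega) (isUnit_mvPolynomial_fin_zero hi) j
  | succ p ih =>
    obtain ⟨i, hi⟩ := exists_ne_zero_of_dotProduct_eq_one hv
    obtain ⟨e, he⟩ := exists_ringEquiv_isUnit_leadingCoeff hi
    refine single_of_ringEquiv e ?_
    obtain ⟨l, hil, -⟩ := exists_ne_ne hm i i
    obtain ⟨t, ht⟩ := exists_monic_add he (e (v l))
    have h1 := update_add_mul (e ∘ v) hil.symm t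
    have huni := h1.exists_dotProduct_eq_one
      (exists_dotProduct_map (e : MvPolynomial (Fin (p + 1)) k →+* (MvPolynomial (Fin p) k)[X]) hv)
    refine h1.trans (single_of_monic_of_forall hm j (fun _ ↦ ih) huni (i := l) ?_)
    rwa [Function.update_self]

theorem InE.corner_of_mvPolynomial {n : ℕ} {p q r s : MvPolynomial (Fin n) k}
    (h : p * s - q * r = 1) : InE (corner p q r s) := by
  induction n with
  | zero =>
    by_cases hq : q = 0
    · have hp : p ≠ 0 := by rintro rfl; simp [hq] at h
      exact corner_col_two 1 (corner_of_isUnit (isUnit_mvPolynomial_fin_zero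
        (by simpa [hq] using hp)) (by linear_combination h))
    · exact corner_of_isUnit (isUnit_mvPolynomial_fin_zero hq) h
  | succ n ih =>
    wlog hp : p ≠ 0 generalizing p q r s
    · rw [not_not] at hp
      refine corner_col_one 1 (this (by linear_combination h) ?_)
      rintro h0
      have hq : q = 0 := by simpa [hp] using h0
      simp [hp, hq] at h
    obtain ⟨e, he⟩ := exists_ringEquiv_isUnit_leadingCoeff hp
    refine corner_of_ringEquiv e ?_
    replace h : e p * e s - e q * e r = 1 := by
      rw [← map_mul, ← map_mul, ← map_sub, h, map_one]
    obtain ⟨t, ht⟩ := exists_monic_add he (e q)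
    refine corner_col_two t ?_
    obtain ⟨t', ht'⟩ := exists_monic_add (f := e q + t * e p) (by rw [ht.leadingCoeff]; simp) (e p)
    refine corner_col_one t' (corner_of_monic_of_forall (fun _ _ _ _ ↦ ih) ht' ?_)
    linear_combination h

theorem mem_of_mvPolynomial (hm : 3 ≤ m) {p : ℕ}
    (g : SpecialLinearGroup (Fin m) (MvPolynomial (Fin p) k)) : g ∈ ElemSubgroup m _ := by
  induction m, hm using Nat.le_induction with
  | base =>
    refine mem_of_colEquiv g (ColEquiv.single_of_mvPolynomial le_rfl 0
      (exists_dotProduct_col_eq_one g 0)) fun A hA ↦ ?_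
    rw [Matrix.det_fin_two] at hA
    convert InE.corner_of_mvPolynomial hA using 1
    ext1 i j
    fin_cases i <;> fin_cases j <;> rfl
  | succ m hm ih =>
    exact mem_of_colEquiv g (ColEquiv.single_of_mvPolynomial (by omega) 0
      (exists_dotProduct_col_eq_one g 0)) fun A hA ↦
        (show InE A from InE.coe_iff.2 (ih ⟨A, hA⟩)).border

end Poly

end ElemSubgroup

namespace ElemSubgroup

open SpecialLinearGroup

section Patching

open Polynomial

variable {m : ℕ}

theorem exists_homotopy {L : Type*} [CommRing L] {g : SpecialLinearGroup (Fin m) L}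
    (hg : g ∈ ElemSubgroup m L) : ∃ σ ∈ ElemSubgroup m L[X],
      SpecialLinearGroup.map (evalRingHom 0) σ = 1 ∧
        SpecialLinearGroup.map (evalRingHom 1) σ = g := by
  have : ElemSubgroup m L ≤
      (ElemSubgroup m L[X] ⊓ (SpecialLinearGroup.map (n := Fin m) (evalRingHom (0 : L))).ker).map
        (SpecialLinearGroup.map (evalRingHom 1)) := by
    refine le_of_transvection_mem fun i j h a ↦
      ⟨transvection h (C a * X), ⟨transvection_mem h _, ?_⟩, ?_⟩
    · refine MonoidHom.mem_ker.2 ?_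
      rw [map_transvection]
      ext1
      simp
    · rw [map_transvection]
      simp
  obtain ⟨σ, ⟨hσ, h0⟩, h1⟩ := this hg
  exact ⟨σ, hσ, h0, h1⟩

/-- Zariski-type patching: `SL_m = E_m` descends from `L` and `T₀` to `T₁`. -/
theorem forall_mem_of_patching (hm : 3 ≤ m) {T₀ T₁ T₂ L : Type*} [CommRing T₀] [CommRing T₁]
    [CommRing T₂] [CommRing L] (ι : T₀ →+* T₁) (φ₁ : T₁ →+* L) (φ₂ : T₂ →+* L)
    (hι : Function.Injective ι) (M₁ : Submonoid T₁) (M₂ : Submonoid T₂)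
    (hunit₁ : ∀ s ∈ M₁, IsUnit (φ₁ s)) (hunit₂ : ∀ s ∈ M₂, IsUnit (φ₂ s))
    (hden₁ : ∀ x : L, ∃ t ∈ M₁, ∃ c, φ₁ t * x = φ₁ c)
    (hden₂ : ∀ x : L, ∃ t ∈ M₂, ∃ c, φ₂ t * x = φ₂ c)
    (hpatch : ∀ s₁ ∈ M₁, ∀ s₂ ∈ M₂, ∃ b c, φ₁ (1 + s₁ * b) = φ₂ (s₂ * c))
    (hinter : ∀ x₁ x₂, φ₁ x₁ = φ₂ x₂ → ∃ x₀, ι x₀ = x₁)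
    (hL : ∀ g, g ∈ ElemSubgroup m L) (h₀ : ∀ g, g ∈ ElemSubgroup m T₀)
    (g : SpecialLinearGroup (Fin m) T₁) : g ∈ ElemSubgroup m T₁ := by
  obtain ⟨σ, hσ, hσ0, hσ1⟩ := exists_homotopy (hL (SpecialLinearGroup.map φ₁ g))
  obtain ⟨s₁, hs₁, H₁⟩ := exists_forall_map_eq hm φ₁ M₁ hunit₁ hden₁ hσ
  obtain ⟨s₂, hs₂, H₂⟩ := exists_forall_map_eq hm φ₂ M₂ hunit₂ hden₂ hσ
  obtain ⟨b, c, hbc⟩ := hpatch s₁ hs₁ s₂ hs₂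
  obtain ⟨ε₁, hε₁, h₁⟩ := H₁ 1 b
  obtain ⟨ε₂, -, h₂⟩ := H₂ 0 c
  rw [map_one, hσ1, hbc] at h₁
  rw [map_zero, hσ0, zero_add, mul_one] at h₂
  have key : SpecialLinearGroup.map φ₁ (g * ε₁⁻¹) = SpecialLinearGroup.map φ₂ ε₂⁻¹ := by
    rw [map_mul, map_inv, map_inv, h₁, h₂]
    group
  choose! f hf using hinter
  have hentry : ∀ i j, ι (f ((g * ε₁⁻¹) i j) (ε₂⁻¹ i j)) = (g * ε₁⁻¹) i j := fun i j ↦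
    hf _ _ (congrFun (congrFun (congrArg Subtype.val key) i) j)
  let B : Matrix (Fin m) (Fin m) T₀ := Matrix.of fun i j ↦ f ((g * ε₁⁻¹) i j) (ε₂⁻¹ i j)
  have hB : ι.mapMatrix B = (g * ε₁⁻¹ : SpecialLinearGroup (Fin m) T₁).1 := by
    ext i j
    exact hentry i j
  have hdet : B.det = 1 := hι (by rw [RingHom.map_det, hB, map_one]; exact (g * ε₁⁻¹).2)
  have hg : SpecialLinearGroup.map ι ⟨B, hdet⟩ = g * ε₁⁻¹ := Subtype.ext hB
  have := map_mem ι (h₀ ⟨B, hdet⟩)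
  rw [hg] at this
  exact (Subgroup.mul_mem_cancel_right _ (inv_mem hε₁)).1 this

end Patching

section Away

open AddMonoidAlgebra

variable {m : ℕ} {M : Type*} [AddCommMonoid M]

theorem mapRingHom_singleZeroRingHom {A B : Type*} [CommRing A] [CommRing B] (φ : A →+* B)
    (a : A) : mapRingHom M φ (singleZeroRingHom a) = singleZeroRingHom (φ a) :=
  mapRingHom_single φ 0 a

theorem exists_mapRingHom_denominator {A B : Type*} [CommRing A] [CommRing B] (φ : A →+* B)
    (N : Submonoid A) (hden : ∀ x : B, ∃ t ∈ N, ∃ c, φ t * x = φ c) (x : AddMonoidAlgebra B M) :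
    ∃ t ∈ N.map (singleZeroRingHom : A →+* AddMonoidAlgebra A M), ∃ c,
      mapRingHom M φ t * x = mapRingHom M φ c := by
  suffices h : ∃ t ∈ N, ∃ c : AddMonoidAlgebra A M, single 0 (φ t) * x = mapRingHom M φ c by
    obtain ⟨t, ht, c, h⟩ := h
    exact ⟨_, Submonoid.mem_map_of_mem _ ht, c, by simpa using h⟩
  induction x using AddMonoidAlgebra.induction_linear with
  | zero => exact ⟨1, one_mem _, 0, by simp⟩
  | add x y hx hy =>
    obtain ⟨t, ht, c, h⟩ := hx
    obtain ⟨t', ht', c', h'⟩ := hy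
    refine ⟨t * t', mul_mem ht ht', single 0 t' * c + single 0 t * c', ?_⟩
    have e : (single 0 (φ (t * t')) : AddMonoidAlgebra B M) =
        single 0 (φ t) * single 0 (φ t') := by simp [single_mul_single]
    rw [e, map_add, map_mul (mapRingHom M φ), map_mul (mapRingHom M φ), ← h, ← h',
      mapRingHom_single, mapRingHom_single]
    ring
  | single i b =>
    obtain ⟨t, ht, c, h⟩ := hden b
    exact ⟨t, ht, single i c, by simp [single_mul_single, h]⟩

theorem isUnit_mapRingHom {A B : Type*} [CommRing A] [CommRing B] (φ : A →+* B)
    (N : Submonoid A) (hN : ∀ s ∈ N, IsUnit (φ s)) :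
    ∀ s ∈ N.map (singleZeroRingHom : A →+* AddMonoidAlgebra A M), IsUnit (mapRingHom M φ s) := by
  rintro _ ⟨s, hs, rfl⟩
  simpa using (hN s hs).map (singleZeroRingHom : B →+* AddMonoidAlgebra B M)

theorem exists_mapRingHom_eq {A B : Type*} [CommRing A] [CommRing B] {φ : A →+* B}
    (hφ : Function.Injective φ) {x : AddMonoidAlgebra B M}
    (hx : ∀ i, ∃ a, φ a = x.coeff i) : ∃ y, mapRingHom M φ y = x := by
  choose f hf using hx
  refine ⟨ofCoeff (Finsupp.onFinset x.coeff.support f fun i hi ↦ ?_), ?_⟩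
  · rw [Finsupp.mem_support_iff, ← hf]
    exact (map_ne_zero_iff φ hφ).2 hi
  · ext i
    simp [hf]

theorem forall_mem_of_away (hm : 3 ≤ m) {D : Type*} [CommRing D] [IsDomain D]
    [IsPrincipalIdealRing D] {x : D} (hx : Irreducible x) (A : Type*) [CommRing A] [Algebra D A]
    [IsLocalization.Away x A]
    (hK : ∀ g, g ∈ ElemSubgroup m (AddMonoidAlgebra (FractionRing D) M))
    (hD : ∀ g, g ∈ ElemSubgroup m (AddMonoidAlgebra D M))
    (g : SpecialLinearGroup (Fin m) (AddMonoidAlgebra A M)) :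
    g ∈ ElemSubgroup m (AddMonoidAlgebra A M) := by
  let K := FractionRing D
  let P := Ideal.span {x}
  have : P.IsPrime := (Ideal.span_singleton_prime hx.ne_zero).2 hx.prime
  let A' := Localization.AtPrime P
  have hP : ∀ f : D, f ∈ P.primeCompl ↔ ¬ x ∣ f := fun f ↦ by
    rw [← Ideal.mem_span_singleton]; rfl
  have hKunit : ∀ f : D, f ≠ 0 → IsUnit (algebraMap D K f) := fun f hf ↦
    isUnit_iff_ne_zero.2 ((map_ne_zero_iff _ (IsFractionRing.injective D K)).2 hf)
  let φ₁ : A →+* K := IsLocalization.lift (M := Submonoid.powers x) (g := algebraMap D K) (by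
    rintro ⟨_, n, rfl⟩
    exact hKunit _ (pow_ne_zero _ hx.ne_zero))
  let φ₂ : A' →+* K := IsLocalization.lift (M := P.primeCompl) (g := algebraMap D K) (by
    rintro ⟨f, hf⟩
    exact hKunit _ (by rintro rfl; exact (hP 0).1 hf (dvd_zero x)))
  have hφ₁ : ∀ d, φ₁ (algebraMap D A d) = algebraMap D K d := fun d ↦ IsLocalization.lift_eq _ d
  have hφ₂ : ∀ d, φ₂ (algebraMap D A' d) = algebraMap D K d := fun d ↦ IsLocalization.lift_eq _ d
  have hι : Function.Injective (algebraMap D A) := IsLocalization.injective A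
    (powers_le_nonZeroDivisors_of_noZeroDivisors hx.ne_zero)
  refine forall_mem_of_patching hm (mapRingHom M (algebraMap D A)) (mapRingHom M φ₁)
    (mapRingHom M φ₂) ?_
    (((nonZeroDivisors D).map (algebraMap D A)).map singleZeroRingHom)
    (((Submonoid.powers x).map (algebraMap D A')).map singleZeroRingHom)
    (isUnit_mapRingHom _ _ ?_) (isUnit_mapRingHom _ _ ?_)
    (exists_mapRingHom_denominator _ _ ?_) (exists_mapRingHom_denominator _ _ ?_) ?_ ?_ hK hD g
  · intro y z h
    ext i
    apply hι
    simpa using congrArg (fun w ↦ w.coeff i) h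
  · rintro _ ⟨f, hf, rfl⟩
    rw [hφ₁]
    exact hKunit _ (nonZeroDivisors.ne_zero hf)
  · rintro _ ⟨_, ⟨n, rfl⟩, rfl⟩
    rw [hφ₂]
    exact hKunit _ (pow_ne_zero _ hx.ne_zero)
  · intro z
    obtain ⟨⟨a, s⟩, h⟩ := IsLocalization.surj (nonZeroDivisors D) z
    refine ⟨_, Submonoid.mem_map_of_mem _ s.2, algebraMap D A a, ?_⟩
    rw [hφ₁, hφ₁, mul_comm, h]
  · intro z
    obtain ⟨⟨a, s⟩, h⟩ := IsLocalization.surj (nonZeroDivisors D) z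
    obtain ⟨n, b, hb, hs⟩ := WfDvdMonoid.max_power_factor (nonZeroDivisors.ne_zero s.2) hx
    have hb0 : b ≠ 0 := by rintro rfl; exact hb (dvd_zero x)
    let b' : P.primeCompl := ⟨b, (hP b).2 hb⟩
    refine ⟨_, Submonoid.mem_map_of_mem _ ⟨n, rfl⟩, IsLocalization.mk' A' a b', ?_⟩
    refine (hKunit b hb0).mul_left_cancel ?_
    rw [← hφ₂ b, ← map_mul φ₂ _ (IsLocalization.mk' _ _ _),
      show algebraMap D A' b * IsLocalization.mk' A' a b' = algebraMap D A' a from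
        IsLocalization.mk'_spec' A' a b', hφ₂, hφ₂, hφ₂, ← h]
    simp only [hs, map_mul]
    ring
  · rintro _ ⟨_, ⟨f, hf, rfl⟩, rfl⟩ _ ⟨_, ⟨_, ⟨N, rfl⟩, rfl⟩, rfl⟩
    obtain ⟨e, f', hf', rfl⟩ := WfDvdMonoid.max_power_factor (nonZeroDivisors.ne_zero hf) hx
    obtain ⟨u, v, huv⟩ := ((hx.coprime_iff_not_dvd).2 hf').pow_left (m := N)
    let w : A := IsLocalization.Away.invSelf x
    have hw : algebraMap D A x * w = 1 := IsLocalization.Away.mul_invSelf x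
    refine ⟨singleZeroRingHom (-(algebraMap D A v * w ^ e)),
      singleZeroRingHom (algebraMap D A' u), ?_⟩
    have h1 : 1 + algebraMap D A (x ^ e * f') * -(algebraMap D A v * w ^ e) =
        algebraMap D A (x ^ N * u) := by
      have : algebraMap D A (u * x ^ N + v * f') = 1 := by rw [huv, map_one]
      have hwe : algebraMap D A x ^ e * w ^ e = 1 := by rw [← mul_pow, hw, one_pow]
      simp only [map_add, map_mul, map_pow] at this ⊢
      linear_combination (-1 : A) * this - algebraMap D A f' * algebraMap D A v * hwe
    rw [← map_mul, ← map_mul, ← map_one (singleZeroRingHom : A →+* AddMonoidAlgebra A M),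
      ← map_add, h1, mapRingHom_singleZeroRingHom, mapRingHom_singleZeroRingHom, hφ₁,
      ← map_mul, hφ₂]
  · intro y₁ y₂ h
    refine exists_mapRingHom_eq hι fun i ↦ ?_
    have hi : φ₁ (y₁.coeff i) = φ₂ (y₂.coeff i) := by
      simpa using congrArg (fun w ↦ w.coeff i) h
    obtain ⟨⟨a, ⟨_, n, rfl⟩⟩, h1⟩ := IsLocalization.surj (Submonoid.powers x) (y₁.coeff i)
    obtain ⟨⟨b, t⟩, h2⟩ := IsLocalization.surj P.primeCompl (y₂.coeff i)
    have h1' := congrArg φ₁ h1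
    have h2' := congrArg φ₂ h2
    simp only [map_mul, hφ₁, hφ₂] at h1' h2'
    have hab : a * t = b * x ^ n := by
      apply IsFractionRing.injective D K
      rw [map_mul, map_mul, ← h1', ← h2', hi]
      ring
    have hdvd : x ^ n ∣ a := by
      have hcop : IsCoprime (x ^ n) (t : D) :=
        ((hx.coprime_iff_not_dvd).2 ((hP _).1 t.2)).pow_left
      exact hcop.dvd_of_dvd_mul_right ⟨b, by rw [hab, mul_comm]⟩
    obtain ⟨d, rfl⟩ := hdvd
    refine ⟨d, (IsLocalization.map_units A (⟨x ^ n, n, rfl⟩ : Submonoid.powers x)).mul_right_cancel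
      ?_⟩
    rw [h1, ← map_mul, mul_comm]

end Away

end ElemSubgroup

namespace ElemSubgroup

section Laurent

open AddMonoidAlgebra

/-- Splitting off the first coordinate of a finitely supported function on `Fin (n + 1)`. -/
noncomputable def consAddEquiv (n : ℕ) (A : Type*) [AddCommMonoid A] :
    (Fin (n + 1) →₀ A) ≃+ A × (Fin n →₀ A) where
  toFun f := (f 0, f.tail)
  invFun x := Finsupp.cons x.1 x.2
  left_inv f := Finsupp.cons_tail f
  right_inv x := by simp
  map_add' f g := by ext <;> simp [Finsupp.tail_apply]

theorem mem_of_addMonoidAlgebra_prod {m : ℕ} (hm : 3 ≤ m) {k : Type*} [Field k] (n p : ℕ)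
    (g : SpecialLinearGroup (Fin m) (AddMonoidAlgebra k ((Fin p →₀ ℕ) × (Fin n →₀ ℤ)))) :
    g ∈ ElemSubgroup m _ := by
  induction n generalizing k p with
  | zero =>
    exact forall_mem_of_ringEquiv
      (mapDomainRingEquiv k (AddEquiv.prodUnique (M := Fin p →₀ ℕ) (N := Fin 0 →₀ ℤ)).symm)
      (fun g ↦ mem_of_mvPolynomial hm (p := p) g) g
  | succ n ih =>
    let M := (Fin p →₀ ℕ) × (Fin n →₀ ℤ)
    have hD : ∀ g, g ∈ ElemSubgroup m (AddMonoidAlgebra (Polynomial k) M) := by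
      refine forall_mem_of_ringEquiv ?_ (ih (k := k) (p + 1))
      refine (mapDomainRingEquiv k (?_ : _ ≃+ M × ℕ)).trans ((curryRingEquiv (R := k)).trans
        (mapRingEquiv M (Polynomial.toFinsuppIso k).symm))
      exact ((consAddEquiv p ℕ).prodCongr (.refl _)).trans
        (AddEquiv.prodAssoc.trans AddEquiv.prodComm)
    have hA : ∀ g, g ∈ ElemSubgroup m (AddMonoidAlgebra (LaurentPolynomial k) M) :=
      forall_mem_of_away hm (D := Polynomial k) Polynomial.irreducible_X (LaurentPolynomial k)
        (ih p) hD
    refine forall_mem_of_ringEquiv ?_ hA g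
    refine (curryRingEquiv (R := k)).symm.trans (mapDomainRingEquiv k ?_)
    exact AddEquiv.prodAssoc.trans ((AddEquiv.refl _).prodCongr
      (AddEquiv.prodComm.trans (consAddEquiv n ℤ).symm))

end Laurent

end ElemSubgroup


/-- For any field `k` and `m ≥ 3`, every matrix in
`SL_m(k[y₁,…,y_p, x₁^{±1},…,xₙ^{±1}])` is a product of elementary matrices:
`SL_m = E_m` over the mixed polynomial/Laurent polynomial ring, i.e.
`K1^{SL_m}(k[y₁,…,y_p, x₁^{±1},…,xₙ^{±1}]) ≅ K1^{SL_m}(k)` is trivial. -/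
theorem sl_eq_elem_mixed_laurent_poly
    (k : Type*) [Field k] (m : ℕ) (hm : 3 ≤ m) (n p : ℕ)
    (g : SpecialLinearGroup (Fin m)
      (MvPolynomial (Fin p) (AddMonoidAlgebra k (Fin n →₀ ℤ)))) :
    g ∈ ElemSubgroup m (MvPolynomial (Fin p) (AddMonoidAlgebra k (Fin n →₀ ℤ))) := by
  exact ElemSubgroup.forall_mem_of_ringEquiv (AddMonoidAlgebra.curryRingEquiv (R := k))
    (ElemSubgroup.mem_of_addMonoidAlgebra_prod hm n p) g
end

section
/- Let R be a commutative ring and m ≥ 3 an integer. Fix indices i ≠ j, an element u ∈ R, an integer n ∈ ℤ, and an integer M ≥ 0. Then there exists an integer N ≥ 0 such that, inside SL_m(R((t))), conjugation by the elementary matrix e_{ij}(u·tⁿ) carries E_m(t^N R[[t]]) into E_m(t^M R[[t]]): e_{ij}(u·tⁿ) · E_m(t^N R[[t]]) · e_{ij}(u·tⁿ)⁻¹ ⊆ E_m(t^M R[[t]]). -/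
open Matrix

/-- The relative elementary subgroup `E_m(I) ⊆ SL_m(S)` generated by the elementary
matrices `e_{ij}(a)` with `i ≠ j` and `a ∈ I`, for an ideal `I` of `S`. -/
def ElemSubgroupIdeal (m : ℕ) (S : Type*) [CommRing S] (I : Ideal S) :
    Subgroup (SpecialLinearGroup (Fin m) S) :=
  Subgroup.closure { g | ∃ i j : Fin m, ∃ a : S, i ≠ j ∧ a ∈ I ∧
    (g : Matrix (Fin m) (Fin m) S) = Matrix.transvection i j a }

/-- The elementary matrix `e_{ij}(a) = 1 + a·E_{ij}` as an element of `SL_m(S)`. -/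
def elemMatrix {m : ℕ} {S : Type*} [CommRing S] (i j : Fin m) (hij : i ≠ j) (a : S) :
    SpecialLinearGroup (Fin m) S :=
  ⟨Matrix.transvection i j a, Matrix.det_transvection_of_ne i j hij a⟩

/-- The Laurent series `t ^ k * f` with `f` a power series, i.e. those with no terms of degree
below `k`. -/
def laurentOrderGE (R : Type*) [CommRing R] (k : ℤ) : Set (HahnSeries ℤ R) :=
  { a | ∃ f : PowerSeries R, a = HahnSeries.single k 1 * HahnSeries.ofPowerSeries ℤ R f }

section laurentOrderGE

variable {R : Type*} [CommRing R]

theorem single_mem_laurentOrderGE (k : ℤ) (u : R) :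
    HahnSeries.single k u ∈ laurentOrderGE R k :=
  ⟨PowerSeries.C u, by
    rw [HahnSeries.ofPowerSeries_C, HahnSeries.C_apply, HahnSeries.single_mul_single, one_mul,
      add_zero]⟩

theorem mul_mem_laurentOrderGE {k l : ℤ} {a b : HahnSeries ℤ R} (ha : a ∈ laurentOrderGE R k)
    (hb : b ∈ laurentOrderGE R l) : a * b ∈ laurentOrderGE R (k + l) := by
  obtain ⟨f, rfl⟩ := ha
  obtain ⟨g, rfl⟩ := hb
  refine ⟨f * g, ?_⟩
  rw [map_mul, mul_mul_mul_comm, HahnSeries.single_mul_single, one_mul]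

theorem mem_laurentOrderGE_natCast {N : ℕ} {a : HahnSeries ℤ R} :
    a ∈ laurentOrderGE R N ↔
      ∃ f ∈ Ideal.span {(PowerSeries.X : PowerSeries R) ^ N},
        HahnSeries.ofPowerSeries ℤ R f = a := by
  have hX : HahnSeries.single (N : ℤ) (1 : R) =
      HahnSeries.ofPowerSeries ℤ R (PowerSeries.X ^ N) :=
    (HahnSeries.ofPowerSeries_X_pow N).symm
  constructor
  · rintro ⟨f, rfl⟩
    exact ⟨PowerSeries.X ^ N * f, Ideal.mem_span_singleton.2 (dvd_mul_right _ _),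
      by rw [map_mul, hX]⟩
  · rintro ⟨f, hf, rfl⟩
    obtain ⟨g, rfl⟩ := Ideal.mem_span_singleton.1 hf
    exact ⟨g, by rw [map_mul, hX]⟩

theorem laurentOrderGE_anti {k l : ℤ} (h : k ≤ l) : laurentOrderGE R l ⊆ laurentOrderGE R k := by
  obtain ⟨d, rfl⟩ := Int.le.dest h
  rintro _ ⟨f, rfl⟩
  refine ⟨PowerSeries.X ^ d * f, ?_⟩
  rw [map_mul, HahnSeries.ofPowerSeries_X_pow, ← mul_assoc, HahnSeries.single_mul_single, one_mul]

theorem exists_mul_eq_of_mem_laurentOrderGE_add {k l : ℤ} {a : HahnSeries ℤ R}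
    (ha : a ∈ laurentOrderGE R (k + l)) :
    ∃ b ∈ laurentOrderGE R k, ∃ c ∈ laurentOrderGE R l, b * c = a := by
  obtain ⟨f, rfl⟩ := ha
  refine ⟨_, single_mem_laurentOrderGE k 1, _, ⟨f, rfl⟩, ?_⟩
  rw [← mul_assoc, HahnSeries.single_mul_single, one_mul]

end laurentOrderGE

section elemMatrix

variable {m : ℕ} {S : Type*} [CommRing S] {i j k l : Fin m}

theorem coe_elemMatrix (hij : i ≠ j) (a : S) :
    (elemMatrix i j hij a : Matrix (Fin m) (Fin m) S) = 1 + single i j a :=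
  rfl

theorem elemMatrix_mul_comm_of_ne (hij : i ≠ j) (hkl : k ≠ l) (hjk : j ≠ k) (hil : i ≠ l)
    (a b : S) :
    elemMatrix i j hij a * elemMatrix k l hkl b = elemMatrix k l hkl b * elemMatrix i j hij a := by
  apply Subtype.ext
  simp [coe_elemMatrix, mul_add, add_mul, hjk, hil.symm]
  abel

/-- The Steinberg relation `[e_{ij}(a), e_{jl}(b)] = e_{il}(ab)`. -/
theorem elemMatrix_mul_elemMatrix_of_ne (hij : i ≠ j) (hjl : j ≠ l) (hil : i ≠ l) (a b : S) :
    elemMatrix i j hij a * elemMatrix j l hjl b =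
      elemMatrix i l hil (a * b) * elemMatrix j l hjl b * elemMatrix i j hij a := by
  apply Subtype.ext
  simp [coe_elemMatrix, mul_add, add_mul, hjl.symm, hil.symm]
  abel

theorem map_elemMatrix {T : Type*} [CommRing T] (hij : i ≠ j) (φ : S →+* T) (a : S) :
    SpecialLinearGroup.map φ (elemMatrix i j hij a) = elemMatrix i j hij (φ a) := by
  apply Subtype.ext
  simp [coe_elemMatrix, Matrix.map_add, Matrix.map_single]

theorem elemMatrix_mem_map_ElemSubgroupIdeal {R : Type*} [CommRing R] {M : ℕ} (hij : i ≠ j)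
    {a : HahnSeries ℤ R} (ha : a ∈ laurentOrderGE R M) :
    elemMatrix i j hij a ∈ (ElemSubgroupIdeal m (PowerSeries R)
        (Ideal.span {(PowerSeries.X : PowerSeries R) ^ M})).map
      (SpecialLinearGroup.map (HahnSeries.ofPowerSeries ℤ R)) := by
  obtain ⟨f, hf, rfl⟩ := mem_laurentOrderGE_natCast.1 ha
  refine ⟨elemMatrix i j hij f, Subgroup.subset_closure ⟨i, j, f, hij, hf, rfl⟩,
    map_elemMatrix hij _ f⟩

theorem map_ElemSubgroupIdeal_le_of_elemMatrix_mem {R : Type*} [CommRing R] {N : ℕ}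
    {H : Subgroup (SpecialLinearGroup (Fin m) (HahnSeries ℤ R))}
    (hH : ∀ (k l : Fin m) (hkl : k ≠ l), ∀ a ∈ laurentOrderGE R N, elemMatrix k l hkl a ∈ H) :
    (ElemSubgroupIdeal m (PowerSeries R)
        (Ideal.span {(PowerSeries.X : PowerSeries R) ^ N})).map
      (SpecialLinearGroup.map (HahnSeries.ofPowerSeries ℤ R)) ≤ H := by
  rw [Subgroup.map_le_iff_le_comap, ElemSubgroupIdeal, Subgroup.closure_le]
  rintro g ⟨k, l, a, hkl, ha, hg⟩
  obtain rfl : g = elemMatrix k l hkl a := Subtype.ext hg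
  simpa only [SetLike.mem_coe, Subgroup.mem_comap, map_elemMatrix] using
    hH k l hkl _ (mem_laurentOrderGE_natCast.2 ⟨a, ha, rfl⟩)

/-- Conjugation by `e_{ij}(c)` sends any elementary matrix not in the opposite root position
`(j, i)` into the elementary subgroup, with controlled loss of order. -/
theorem conj_elemMatrix_mem_of_not_opposite {R : Type*} [CommRing R] {n N : ℤ} {M : ℕ}
    (hij : i ≠ j) (hkl : k ≠ l) (hopp : ¬(k = j ∧ l = i)) (hN : M ≤ N) (hnN : M ≤ n + N)
    {c a : HahnSeries ℤ R} (hc : c ∈ laurentOrderGE R n) (ha : a ∈ laurentOrderGE R N) :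
    elemMatrix i j hij c * elemMatrix k l hkl a * (elemMatrix i j hij c)⁻¹ ∈
      (ElemSubgroupIdeal m (PowerSeries R)
        (Ideal.span {(PowerSeries.X : PowerSeries R) ^ M})).map
      (SpecialLinearGroup.map (HahnSeries.ofPowerSeries ℤ R)) := by
  have haM := elemMatrix_mem_map_ElemSubgroupIdeal hkl (laurentOrderGE_anti hN ha)
  by_cases hkj : k = j
  · subst hkj
    have hil : i ≠ l := fun h => hopp ⟨rfl, h.symm⟩
    rw [elemMatrix_mul_elemMatrix_of_ne hij hkl hil, mul_inv_cancel_right]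
    exact mul_mem (elemMatrix_mem_map_ElemSubgroupIdeal hil
      (laurentOrderGE_anti hnN (mul_mem_laurentOrderGE hc ha))) haM
  by_cases hli : l = i
  · subst hli
    have h := elemMatrix_mul_elemMatrix_of_ne hkl hij hkj a c
    rw [mul_assoc, ← inv_mul_eq_iff_eq_mul] at h
    rw [← h, mul_assoc, mul_inv_cancel_right]
    refine mul_mem (inv_mem (elemMatrix_mem_map_ElemSubgroupIdeal hkj
      (laurentOrderGE_anti hnN ?_))) haM
    rw [mul_comm]
    exact mul_mem_laurentOrderGE hc ha
  · rwa [elemMatrix_mul_comm_of_ne hij hkl (Ne.symm hkj) (Ne.symm hli), mul_inv_cancel_right]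

end elemMatrix

/-- The key conjugation estimate (3.6) of the paper, for `SL_m` (`m ≥ 3`): given
`i ≠ j`, `u ∈ R`, `n ∈ ℤ` and `M ≥ 0`, there is `N ≥ 0` such that, inside
`SL_m(R((t)))`, conjugation by `e_{ij}(u·tⁿ)` carries `E_m(t^N R[[t]])` into
`E_m(t^M R[[t]])`. -/
theorem conj_elementary_ideal_estimate
    (R : Type*) [CommRing R] (m : ℕ) (hm : 3 ≤ m)
    (i j : Fin m) (hij : i ≠ j) (u : R) (n : ℤ) (M : ℕ) :
    ∃ N : ℕ,
      ∀ h ∈ (ElemSubgroupIdeal m (PowerSeries R)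
              (Ideal.span {(PowerSeries.X : PowerSeries R) ^ N})).map
            (SpecialLinearGroup.map (HahnSeries.ofPowerSeries ℤ R)),
        elemMatrix i j hij (HahnSeries.single n u) * h *
            (elemMatrix i j hij (HahnSeries.single n u))⁻¹
          ∈ (ElemSubgroupIdeal m (PowerSeries R)
              (Ideal.span {(PowerSeries.X : PowerSeries R) ^ M})).map
            (SpecialLinearGroup.map (HahnSeries.ofPowerSeries ℤ R)) := by
  set H := (ElemSubgroupIdeal m (PowerSeries R)
    (Ideal.span {(PowerSeries.X : PowerSeries R) ^ M})).map
      (SpecialLinearGroup.map (HahnSeries.ofPowerSeries ℤ R))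
  set x := elemMatrix i j hij (HahnSeries.single n u)
  let K := M + n.natAbs
  have hMK : (M : ℤ) ≤ (K : ℤ) := by lia
  have hMnK : (M : ℤ) ≤ n + K := by lia
  have conj_mem : ∀ (k l : Fin m) (hkl : k ≠ l), ¬(k = j ∧ l = i) → ∀ a ∈ laurentOrderGE R K,
      elemMatrix k l hkl a ∈ H.comap (MulAut.conj x).toMonoidHom :=
    fun k l hkl hopp a ha => conj_elemMatrix_mem_of_not_opposite hij hkl hopp hMK hMnK
      (single_mem_laurentOrderGE n u) ha
  refine ⟨K + K, fun h hh => map_ElemSubgroupIdeal_le_of_elemMatrix_mem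
    (H := H.comap (MulAut.conj x).toMonoidHom) (fun k l hkl a ha => ?_) hh⟩
  by_cases hopp : k = j ∧ l = i
  · obtain ⟨rfl, rfl⟩ := hopp
    obtain ⟨p, hp⟩ : ∃ p : Fin m, p ∉ ({k, l} : Finset (Fin m)) := by
      by_contra! hall
      have := Finset.card_le_card (fun q _ => hall q : Finset.univ ⊆ ({k, l} : Finset (Fin m)))
      have := Finset.card_le_two (a := k) (b := l)
      simp at *
      lia
    simp only [Finset.mem_insert, Finset.mem_singleton, not_or] at hp
    push_cast at ha
    obtain ⟨b, hb, c, hc, rfl⟩ := exists_mul_eq_of_mem_laurentOrderGE_add ha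
    have hbmem := conj_mem k p (Ne.symm hp.1) (fun h => hp.2 h.2) b hb
    have hcmem := conj_mem p l hp.2 (fun h => hp.1 h.1) c hc
    have h := elemMatrix_mul_elemMatrix_of_ne (Ne.symm hp.1) hp.2 hkl b c
    rw [mul_assoc, ← mul_inv_eq_iff_eq_mul] at h
    rw [← h]
    exact mul_mem (mul_mem hbmem hcmem) (inv_mem (mul_mem hcmem hbmem))
  · exact conj_mem k l hkl hopp a (laurentOrderGE_anti (by lia) ha)
end
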